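/- arXiv:2007.02597 — 2 statements merged into one kernel-verified Lean document; each statement's English description precedes it below -/
import Mathlib

section
/- Transport stability estimate: Let T > 0 and u ∈ L∞(0,T; W^{1,∞}(ℝ³;ℝ³)). For every ρ₀ ∈ L¹(ℝ³) ∩ L∞(ℝ³) there exists a unique solution ρ ∈ L∞(0,T; L¹ ∩ L∞) of ∂_t ρ + div(ρ u) = 0, ρ(0,·) = ρ₀. Moreover, if u₁, u₂ ∈ L∞(0,T; W^{1,∞}(ℝ³;ℝ³)) and ρ₁, ρ₂ are nonnegative solutions of the associated transport equations with equal total mass and finite first moments, then for all 0 ≤ s ≤ t ≤ T: W₁(ρ₁(t), ρ₂(t)) ≤ ( W₁(ρ₁(s), ρ₂(s)) + ∫_s^t ∫_{ℝ³} |u₂(τ,x) − u₁(τ,x)| ρ₁(τ,x) dx dτ ) · e^{Q₂ (t−s)}, where Q₂ = ‖u₂‖_{L∞(0,T; W^{1,∞})}. -/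
/- Transport stability estimate: for u ∈ L∞(0,T;W^{1,∞}) and ρ₀ ∈ L¹ ∩ L∞ there exists a
   unique distributional solution ρ ∈ L∞(0,T;L¹ ∩ L∞) of ∂_tρ + div(ρu) = 0, ρ(0,·) = ρ₀; and
   for two velocity fields u₁, u₂ and nonnegative solutions ρ₁, ρ₂ with equal total mass and
   finite first moments, for 0 ≤ s ≤ t ≤ T:
   W₁(ρ₁(t),ρ₂(t)) ≤ ( W₁(ρ₁(s),ρ₂(s)) + ∫_s^t ∫ |u₂−u₁| ρ₁ ) e^{Q₂ (t−s)},
   Q₂ = ‖u₂‖_{L∞(0,T;W^{1,∞})}. -/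

noncomputable section
open MeasureTheory Real Set Filter RealInnerProductSpace

local notation "E3" => EuclideanSpace ℝ (Fin 3)

/-- First Wasserstein distance between two measures on ℝ³ (as an extended real). -/
def W1 (μ ν : Measure (EuclideanSpace ℝ (Fin 3))) : ENNReal :=
  ⨅ γ ∈ {γ : Measure (EuclideanSpace ℝ (Fin 3) × EuclideanSpace ℝ (Fin 3)) |
      γ.map Prod.fst = μ ∧ γ.map Prod.snd = ν},
    ∫⁻ p, ‖p.1 - p.2‖₊ ∂γ

/-- The measure with density η with respect to Lebesgue measure. -/
def densM (η : EuclideanSpace ℝ (Fin 3) → ℝ) : Measure (EuclideanSpace ℝ (Fin 3)) :=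
  volume.withDensity fun x => ENNReal.ofReal (η x)

/-- ρ ∈ L∞(0,T; L¹ ∩ L∞). -/
def InL1Linfty (T : ℝ) (ρ : ℝ → EuclideanSpace ℝ (Fin 3) → ℝ) : Prop :=
  ∃ M, ∀ t ∈ Set.Icc 0 T, Integrable (ρ t) ∧ (∀ᵐ x, |ρ t x| ≤ M)

/-- u ∈ L∞(0,T; W^{1,∞}(ℝ³;ℝ³)), with bound Q, together with measurability in time. -/
def InW1inftyBdd (T Q : ℝ) (u : ℝ → EuclideanSpace ℝ (Fin 3) → EuclideanSpace ℝ (Fin 3)) :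
    Prop :=
  (∀ x, AEStronglyMeasurable (fun t => u t x) (volume.restrict (Set.Icc 0 T))) ∧
  ∀ t ∈ Set.Icc 0 T, (∀ x, ‖u t x‖ ≤ Q) ∧ (∀ x y, ‖u t x - u t y‖ ≤ Q * ‖x - y‖)

/-- Distributional solution of the transport equation ∂_tρ + div(ρu) = 0 with datum ρ₀ on [0,T],
in the time-sliced weak formulation. -/
def IsTransportSol (T : ℝ) (u : ℝ → EuclideanSpace ℝ (Fin 3) → EuclideanSpace ℝ (Fin 3))
    (ρ₀ : EuclideanSpace ℝ (Fin 3) → ℝ) (ρ : ℝ → EuclideanSpace ℝ (Fin 3) → ℝ) : Prop :=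
  ∀ ψ : ℝ → EuclideanSpace ℝ (Fin 3) → ℝ,
    ContDiff ℝ (⊤ : ℕ∞) (fun p : ℝ × EuclideanSpace ℝ (Fin 3) => ψ p.1 p.2) →
    HasCompactSupport (fun p : ℝ × EuclideanSpace ℝ (Fin 3) => ψ p.1 p.2) →
    ∀ t ∈ Set.Icc 0 T,
      (∫ x, ρ t x * ψ t x) = (∫ x, ρ₀ x * ψ 0 x) +
        ∫ τ in (0:ℝ)..t, ∫ x,
          ρ τ x * (deriv (fun s => ψ s x) τ + ⟪u τ x, gradient (ψ τ) x⟫)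


open scoped Topology BoundedContinuousFunction

/-- A globally defined velocity field, measurable in time, bounded and Lipschitz in space. -/
structure GoodV (Q : ℝ) (v : ℝ → E3 → E3) : Prop where
  Q0 : 0 ≤ Q
  meas : ∀ x, Measurable (fun t => v t x)
  bdd : ∀ t x, ‖v t x‖ ≤ Q
  lip : ∀ t x y, ‖v t x - v t y‖ ≤ Q * ‖x - y‖

lemma exists_good {T Q : ℝ} {u : ℝ → E3 → E3} (hT : 0 < T) (h : InW1inftyBdd T Q u) :
    ∃ v, GoodV Q v ∧ ∀ᵐ t ∂(volume.restrict (Icc 0 T)), v t = u t := by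
  obtain ⟨h1, h2⟩ := h
  have hQ : 0 ≤ Q := (norm_nonneg _).trans ((h2 0 ⟨le_rfl, hT.le⟩).1 0)
  have hae : ∀ᵐ t ∂(volume.restrict (Icc 0 T)), t ∈ Icc 0 T ∧
      ∀ n : ℕ, u t (TopologicalSpace.denseSeq E3 n) = (h1 (TopologicalSpace.denseSeq E3 n)).mk _ t := by
    refine (ae_restrict_mem measurableSet_Icc).and (ae_all_iff.2 fun n => ?_)
    exact (h1 (TopologicalSpace.denseSeq E3 n)).ae_eq_mk
  obtain ⟨S, hS, hSm, hSp⟩ := hae.exists_measurable_mem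
  classical
  let v : ℝ → E3 → E3 := fun t x => if t ∈ S then u t x else 0
  have vlip : ∀ t x y, ‖v t x - v t y‖ ≤ Q * ‖x - y‖ := by
    intro t x y
    by_cases ht : t ∈ S
    · simpa [v, ht] using (h2 t (hSp t ht).1).2 x y
    · simp only [v, ht, if_false, sub_self, norm_zero]; positivity
  refine ⟨v, ⟨hQ, ?_, ?_, vlip⟩, ?_⟩
  · have hd : ∀ n, Measurable (fun t => v t (TopologicalSpace.denseSeq E3 n)) := by
      intro n
      have : (fun t => v t (TopologicalSpace.denseSeq E3 n)) =
          S.indicator ((h1 (TopologicalSpace.denseSeq E3 n)).mk _) := by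
        ext1 t
        by_cases ht : t ∈ S
        · simp only [v, ht, if_true, indicator_of_mem]
          exact (hSp t ht).2 n
        · simp [v, ht]
      rw [this]
      exact (h1 _).stronglyMeasurable_mk.measurable.indicator hSm
    intro x
    obtain ⟨y, hy, hyx⟩ := mem_closure_iff_seq_limit.1
      ((TopologicalSpace.denseRange_denseSeq E3).closure_range ▸ mem_univ x)
    refine measurable_of_tendsto_metrizable (f := fun n t => v t (y n)) ?_ ?_
    · intro n
      obtain ⟨m, hm⟩ := hy n
      simpa only [← hm] using hd m
    · rw [tendsto_pi_nhds]
      intro t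
      have : LipschitzWith Q.toNNReal (v t) := LipschitzWith.of_dist_le_mul fun a b => by
        simpa [dist_eq_norm, hQ] using vlip t a b
      exact (this.continuous.tendsto x).comp hyx
  · intro t x
    by_cases ht : t ∈ S
    · simpa [v, ht] using (h2 t (hSp t ht).1).1 x
    · simp only [v, ht, if_false, norm_zero]; exact hQ
  · filter_upwards [hS] with t ht
    ext1 x
    simp [v, ht]

namespace GoodV
variable {Q : ℝ} {v : ℝ → E3 → E3}

lemma lipW (h : GoodV Q v) (t : ℝ) : LipschitzWith Q.toNNReal (v t) :=
  LipschitzWith.of_dist_le_mul fun a b => by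
    simpa [dist_eq_norm, h.Q0] using h.lip t a b

lemma cont (h : GoodV Q v) (t : ℝ) : Continuous (v t) := (h.lipW t).continuous

lemma measU (h : GoodV Q v) : Measurable (fun p : ℝ × E3 => v p.1 p.2) := by
  have := measurable_uncurry_of_continuous_of_measurable (u := fun (x : E3) (t : ℝ) => v t x)
    (fun t => h.cont t) h.meas
  exact this.comp measurable_swap

lemma measC (h : GoodV Q v) {z : ℝ → E3} (hz : Measurable z) : Measurable (fun t => v t (z t)) :=
  h.measU.comp (measurable_id.prodMk hz)

lemma ii (h : GoodV Q v) {z : ℝ → E3} (hz : Measurable z) (a b : ℝ) :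
    IntervalIntegrable (fun t => v t (z t)) volume a b := by
  refine (intervalIntegrable_const (c := Q)).mono_fun (h.measC hz).aestronglyMeasurable ?_
  refine Eventually.of_forall fun t => ?_
  simpa [abs_of_nonneg h.Q0] using h.bdd t (z t)

end GoodV

lemma expint {k s t : ℝ} (hk : 0 < k) :
    |∫ τ in s..t, exp (k * |τ - s|)| ≤ exp (k * |t - s|) / k := by
  rcases le_total s t with hst | hst
  · have h1 : ∫ τ in s..t, exp (k * |τ - s|) = ∫ τ in s..t, exp (k * (τ - s)) := by
      refine intervalIntegral.integral_congr fun τ hτ => ?_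
      rw [uIcc_of_le hst] at hτ
      simp only [abs_of_nonneg (sub_nonneg.2 hτ.1)]
    have h2 : ∫ τ in s..t, exp (k * (τ - s)) = exp (k * (t - s)) / k - exp (k * (s - s)) / k := by
      refine intervalIntegral.integral_eq_sub_of_hasDerivAt (f := fun τ => exp (k * (τ - s)) / k) ?_ ?_
      · intro x _
        have := ((((hasDerivAt_id x).sub_const s).const_mul k).exp).div_const k
        simp only [id] at this
        refine this.congr_deriv ?_
        rw [div_eq_iff hk.ne']; ring
      · exact (by fun_prop : Continuous fun τ => exp (k * (τ - s))).intervalIntegrable _ _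
    rw [h1, h2, abs_of_nonneg (sub_nonneg.2 hst)]
    rw [abs_of_nonneg]
    · simp; positivity
    · rw [sub_nonneg]; gcongr
  · have h1 : ∫ τ in s..t, exp (k * |τ - s|) = ∫ τ in s..t, exp (k * (s - τ)) := by
      refine intervalIntegral.integral_congr fun τ hτ => ?_
      rw [uIcc_of_ge hst] at hτ
      simp only [abs_of_nonpos (sub_nonpos.2 hτ.2), neg_sub]
    have h2 : ∫ τ in s..t, exp (k * (s - τ)) = -exp (k * (s - t)) / k - -exp (k * (s - s)) / k := by
      refine intervalIntegral.integral_eq_sub_of_hasDerivAt (f := fun τ => -exp (k * (s - τ)) / k) ?_ ?_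
      · intro x _
        have := ((((hasDerivAt_id x).const_sub s).const_mul k).exp).neg.div_const k
        simp only [id] at this
        refine this.congr_deriv ?_
        rw [div_eq_iff hk.ne']; ring
      · exact (by fun_prop : Continuous fun τ => exp (k * (s - τ))).intervalIntegrable _ _
    rw [h1, h2, abs_of_nonpos (sub_nonpos.2 hst), neg_sub]
    rw [abs_of_nonpos]
    · have : 0 ≤ exp (k * (s - s)) / k := by positivity
      have e : -exp (k * (s - t)) / k = -(exp (k * (s - t)) / k) := by ring
      have e' : -exp (k * (s - s)) / k = -(exp (k * (s - s)) / k) := by ring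
      rw [e, e']; linarith
    · rw [sub_nonpos]; gcongr

lemma gron {f : ℝ → ℝ} {a Q s b : ℝ} (hf : Continuous f) (hQ : 0 ≤ Q) (hsb : s ≤ b)
    (h : ∀ t ∈ Icc s b, f t ≤ a + Q * ∫ τ in s..t, f τ) : f b ≤ a * exp (Q * (b - s)) := by
  set F : ℝ → ℝ := fun t => a + Q * ∫ τ in s..t, f τ with hF
  have hd : ∀ t, HasDerivAt F (Q * f t) t := fun t => by
    have := (intervalIntegral.integral_hasDerivAt_right (hf.intervalIntegrable s t)
      (hf.stronglyMeasurableAtFilter _ _) hf.continuousAt)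
    exact (this.const_mul Q).const_add a
  have hG : ∀ t, HasDerivAt (fun t => F t * exp (-(Q * t)))
      (Q * f t * exp (-(Q * t)) + F t * (exp (-(Q * t)) * -(Q * 1))) t := fun t =>
    (hd t).mul (((hasDerivAt_id t).const_mul Q).neg.exp)
  have hanti : AntitoneOn (fun t => F t * exp (-(Q * t))) (Icc s b) := by
    refine antitoneOn_of_deriv_nonpos (convex_Icc s b)
      (fun t _ => (hG t).continuousAt.continuousWithinAt)
      (fun t _ => (hG t).differentiableAt.differentiableWithinAt) ?_
    intro t ht
    rw [interior_Icc] at ht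
    rw [(hG t).deriv]
    have h1 := h t ⟨ht.1.le, ht.2.le⟩
    have : Q * f t * exp (-(Q * t)) + F t * (exp (-(Q * t)) * -(Q * 1)) =
      -(Q * exp (-(Q * t)) * (F t - f t)) := by ring
    rw [this]
    have h2 : 0 ≤ F t - f t := sub_nonneg.2 h1
    have : 0 ≤ Q * exp (-(Q * t)) * (F t - f t) := by positivity
    linarith
  have h1 := hanti (left_mem_Icc.2 hsb) (right_mem_Icc.2 hsb) hsb
  have hFs : F s = a := by simp [hF]
  simp only [hFs] at h1
  have h2 := h b (right_mem_Icc.2 hsb)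
  have h3 : F b = (F b * exp (-(Q * b))) * exp (Q * b) := by
    rw [mul_assoc, ← exp_add]; simp
  calc f b ≤ F b := h2
    _ = (F b * exp (-(Q * b))) * exp (Q * b) := h3
    _ ≤ (a * exp (-(Q * s))) * exp (Q * b) := by gcongr
    _ = a * exp (Q * (b - s)) := by rw [mul_assoc, ← exp_add]; ring_nf

/-- Integral curves of `v` in the Caratheodory sense. -/
def IsTraj (v : ℝ → E3 → E3) (z : ℝ → E3) : Prop :=
  Continuous z ∧ ∀ s t, z t - z s = ∫ τ in s..t, v τ (z τ)

namespace GoodV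
variable {Q : ℝ} {v : ℝ → E3 → E3}

lemma exists_traj (h : GoodV Q v) (s : ℝ) (x : E3) : ∃ z, IsTraj v z ∧ z s = x := by
  set k : ℝ := 2 * Q + 1 with hk
  have hQ := h.Q0
  have hk0 : 0 < k := by positivity
  have hc : ∀ Z : ℝ →ᵇ E3, Continuous (fun τ => x + exp (k * |τ - s|) • Z τ) := fun Z => by
    have := Z.continuous
    fun_prop
  have hPc : ∀ Z : ℝ →ᵇ E3, Continuous (fun t => exp (-(k * |t - s|)) •
      ∫ τ in s..t, v τ (x + exp (k * |τ - s|) • Z τ)) := fun Z => by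
    have := intervalIntegral.continuous_primitive (fun a b => h.ii (hc Z).measurable a b) s
    fun_prop
  have hPb : ∀ (Z : ℝ →ᵇ E3) t, ‖exp (-(k * |t - s|)) •
      ∫ τ in s..t, v τ (x + exp (k * |τ - s|) • Z τ)‖ ≤ 1 := fun Z t => by
    rw [norm_smul, norm_of_nonneg (exp_pos _).le]
    have h1 : ‖∫ τ in s..t, v τ (x + exp (k * |τ - s|) • Z τ)‖ ≤ Q * |t - s| :=
      intervalIntegral.norm_integral_le_of_norm_le_const fun τ _ => h.bdd _ _
    have h2 : Q * |t - s| ≤ exp (k * |t - s|) := by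
      have := add_one_le_exp (k * |t - s|)
      have h3 : Q * |t - s| ≤ k * |t - s| := by
        gcongr; rw [hk]; linarith
      linarith
    calc _ ≤ exp (-(k * |t - s|)) * exp (k * |t - s|) := by gcongr; exact h1.trans h2
      _ = 1 := by rw [← exp_add]; simp
  let P : (ℝ →ᵇ E3) → (ℝ →ᵇ E3) := fun Z =>
    BoundedContinuousFunction.ofNormedAddCommGroup _ (hPc Z) 1 (hPb Z)
  have hP : ContractingWith (1/2) P := by
    refine ⟨by rw [← NNReal.coe_lt_coe]; norm_num, LipschitzWith.of_dist_le_mul fun Z W => ?_⟩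
    rw [BoundedContinuousFunction.dist_le (by positivity)]
    intro t
    rw [dist_eq_norm]
    change ‖exp (-(k * |t - s|)) • (∫ τ in s..t, v τ (x + exp (k * |τ - s|) • Z τ)) -
      exp (-(k * |t - s|)) • (∫ τ in s..t, v τ (x + exp (k * |τ - s|) • W τ))‖ ≤ _
    rw [← smul_sub, ← intervalIntegral.integral_sub (h.ii (hc Z).measurable _ _)
      (h.ii (hc W).measurable _ _), norm_smul, norm_of_nonneg (exp_pos _).le]
    have h1 : ‖∫ τ in s..t, (v τ (x + exp (k * |τ - s|) • Z τ) - v τ (x + exp (k * |τ - s|) • W τ))‖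
        ≤ |∫ τ in s..t, Q * dist Z W * exp (k * |τ - s|)| := by
      refine intervalIntegral.norm_integral_le_abs_of_norm_le ?_ ?_
      · refine Eventually.of_forall fun τ => ?_
        refine (h.lip _ _ _).trans ?_
        rw [add_sub_add_left_eq_sub, ← smul_sub, norm_smul, norm_of_nonneg (exp_pos _).le]
        have : ‖Z τ - W τ‖ ≤ dist Z W := by
          rw [← dist_eq_norm]; exact BoundedContinuousFunction.dist_coe_le_dist τ
        calc _ ≤ Q * (exp (k * |τ - s|) * dist Z W) := by gcongr
          _ = _ := by ring
      · exact (by fun_prop : Continuous fun τ => Q * dist Z W * exp (k * |τ - s|)).intervalIntegrable _ _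
    rw [intervalIntegral.integral_const_mul, abs_mul, abs_of_nonneg (by positivity)] at h1
    have h2 := expint (s := s) (t := t) hk0
    calc _ ≤ exp (-(k * |t - s|)) * (Q * dist Z W * (exp (k * |t - s|) / k)) := by
          gcongr; exact h1.trans (by gcongr)
      _ = (exp (-(k * |t - s|)) * exp (k * |t - s|)) * (Q / k) * dist Z W := by ring
      _ = (Q / k) * dist Z W := by rw [← exp_add]; simp
      _ ≤ _ := by
          gcongr
          rw [div_le_iff₀ hk0]
          norm_num
          rw [hk]; linarith
  obtain ⟨Z, hZ⟩ : ∃ Z, P Z = Z := ⟨_, hP.fixedPoint_isFixedPt⟩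
  refine ⟨fun τ => x + exp (k * |τ - s|) • Z τ, ⟨hc Z, ?_⟩, ?_⟩
  · have key : ∀ t, exp (k * |t - s|) • Z t = ∫ τ in s..t, v τ (x + exp (k * |τ - s|) • Z τ) := by
      intro t
      have h1 : Z t = exp (-(k * |t - s|)) • ∫ τ in s..t, v τ (x + exp (k * |τ - s|) • Z τ) := by
        conv_lhs => rw [← hZ]
        rfl
      rw [h1, smul_smul, ← exp_add]; simp
    intro a b
    rw [add_sub_add_left_eq_sub, key a, key b]
    rw [intervalIntegral.integral_interval_sub_left] <;> exact h.ii (hc Z).measurable _ _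
  · have h1 : Z s = exp (-(k * |s - s|)) • ∫ τ in s..s, v τ (x + exp (k * |τ - s|) • Z τ) := by
      conv_lhs => rw [← hZ]
      rfl
    simp [h1]

lemma traj_lip (h : GoodV Q v) {z : ℝ → E3} (hz : IsTraj v z) (s t : ℝ) :
    ‖z t - z s‖ ≤ Q * |t - s| := by
  rw [hz.2 s t]
  exact intervalIntegral.norm_integral_le_of_norm_le_const fun τ _ => h.bdd _ _

lemma traj_dist (h : GoodV Q v) {z w : ℝ → E3} (hz : IsTraj v z) (hw : IsTraj v w) (s t : ℝ) :
    ‖z t - w t‖ ≤ ‖z s - w s‖ * exp (Q * |t - s|) := by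
  have hzc := hz.1
  have hwc := hw.1
  have e : ∀ s t, z t - w t = z s - w s + ∫ τ in s..t, (v τ (z τ) - v τ (w τ)) := by
    intro s t
    rw [intervalIntegral.integral_sub (h.ii hzc.measurable _ _) (h.ii hwc.measurable _ _),
      ← hz.2, ← hw.2]
    abel
  have hfc : Continuous fun r => ‖z r - w r‖ := by fun_prop
  rcases le_total s t with hst | hst
  · rw [abs_of_nonneg (sub_nonneg.2 hst)]
    refine gron (f := fun r => ‖z r - w r‖) hfc h.Q0 hst fun r hr => ?_
    rw [e s r, ← intervalIntegral.integral_const_mul]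
    refine (norm_add_le _ _).trans ?_
    gcongr
    refine intervalIntegral.norm_integral_le_of_norm_le hr.1
      (Eventually.of_forall fun τ _ => h.lip _ _ _) ?_
    exact (hfc.const_mul Q).intervalIntegrable _ _
  · have hfc' : Continuous fun r => ‖z (s - r) - w (s - r)‖ := by fun_prop
    have := gron (f := fun r => ‖z (s - r) - w (s - r)‖) (a := ‖z s - w s‖) (s := 0) (b := s - t)
      hfc' h.Q0 (sub_nonneg.2 hst) fun r hr => ?_
    · rw [abs_of_nonpos (sub_nonpos.2 hst), neg_sub]
      simpa using this
    · rw [intervalIntegral.integral_comp_sub_left (fun y => ‖z y - w y‖) s, sub_zero]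
      rw [e s (s - r), intervalIntegral.integral_symm, ← intervalIntegral.integral_const_mul]
      refine (norm_add_le _ _).trans ?_
      rw [norm_neg]
      gcongr
      refine intervalIntegral.norm_integral_le_of_norm_le (by linarith [hr.1])
        (Eventually.of_forall fun τ _ => h.lip _ _ _) ?_
      exact (hfc.const_mul Q).intervalIntegrable _ _

/-- The flow: position at time `t` of the trajectory which is at `x` at time `s`. -/
def flow (h : GoodV Q v) (s t : ℝ) (x : E3) : E3 := (h.exists_traj s x).choose t

lemma flow_traj (h : GoodV Q v) (s : ℝ) (x : E3) : IsTraj v (fun t => h.flow s t x) :=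
  (h.exists_traj s x).choose_spec.1

lemma flow_self (h : GoodV Q v) (s : ℝ) (x : E3) : h.flow s s x = x :=
  (h.exists_traj s x).choose_spec.2

lemma flow_comp (h : GoodV Q v) (r s t : ℝ) (x : E3) :
    h.flow s t (h.flow r s x) = h.flow r t x := by
  have := h.traj_dist (h.flow_traj s (h.flow r s x)) (h.flow_traj r x) s t
  simp only [h.flow_self, sub_self, norm_zero, zero_mul] at this
  exact sub_eq_zero.1 (norm_eq_zero.1 (le_antisymm this (norm_nonneg _)))

lemma flow_inv (h : GoodV Q v) (s t : ℝ) (x : E3) : h.flow t s (h.flow s t x) = x := by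
  rw [h.flow_comp, h.flow_self]

lemma flow_lip (h : GoodV Q v) (s t : ℝ) :
    LipschitzWith (exp (Q * |t - s|)).toNNReal (h.flow s t) :=
  LipschitzWith.of_dist_le_mul fun x y => by
    have := h.traj_dist (h.flow_traj s x) (h.flow_traj s y) s t
    simp only [h.flow_self] at this
    rw [dist_eq_norm, dist_eq_norm, Real.coe_toNNReal _ (exp_pos _).le, mul_comm]
    exact this

lemma flow_cont (h : GoodV Q v) (s t : ℝ) : Continuous (h.flow s t) := (h.flow_lip s t).continuous

lemma flow_meas (h : GoodV Q v) (s : ℝ) : Measurable (fun p : ℝ × E3 => h.flow s p.1 p.2) := by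
  have := measurable_uncurry_of_continuous_of_measurable
    (u := fun (x : E3) (t : ℝ) => h.flow s t x)
    (fun t => h.flow_cont s t) (fun x => (h.flow_traj s x).1.measurable)
  exact this.comp measurable_swap

end GoodV

lemma vol_image_le {K : NNReal} {f : E3 → E3} (hf : LipschitzWith K f) (s : Set E3) :
    volume (f '' s) ≤ (K : ENNReal) ^ 3 * volume s := by
  have e : (volume : Measure E3) = Measure.addHaarScalarFactor (volume : Measure E3)
      (Measure.hausdorffMeasure (3 : ℕ)) • (Measure.hausdorffMeasure (3 : ℕ)) :=
    Measure.isAddLeftInvariant_eq_smul _ _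
  have h1 := hf.hausdorffMeasure_image_le (d := ((3 : ℕ) : ℝ)) (by positivity) s
  rw [ENNReal.rpow_natCast] at h1
  set c := Measure.addHaarScalarFactor (volume : Measure E3) (Measure.hausdorffMeasure (3 : ℕ))
  rw [e]
  simp only [Measure.smul_apply, ENNReal.smul_def, smul_eq_mul]
  calc _ ≤ (c : ENNReal) * ((K : ENNReal) ^ 3 * Measure.hausdorffMeasure (3 : ℕ) s) := by gcongr
    _ = _ := by ring

namespace GoodV
variable {Q : ℝ} {v : ℝ → E3 → E3}

/-- The flow as a homeomorphism. -/
def flowH (h : GoodV Q v) (s t : ℝ) : E3 ≃ₜ E3 where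
  toFun := h.flow s t
  invFun := h.flow t s
  left_inv := h.flow_inv s t
  right_inv := h.flow_inv t s
  continuous_toFun := h.flow_cont s t
  continuous_invFun := h.flow_cont t s

lemma flow_me (h : GoodV Q v) (s t : ℝ) : MeasurableEmbedding (h.flow s t) :=
  (h.flowH s t).measurableEmbedding

lemma map_flow_le (h : GoodV Q v) (s t : ℝ) :
    volume.map (h.flow s t) ≤ ((exp (Q * |s - t|)).toNNReal ^ 3 : NNReal) • (volume : Measure E3) := by
  refine Measure.le_iff.2 fun A hA => ?_
  rw [Measure.map_apply (h.flow_cont s t).measurable hA]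
  have h1 : h.flow s t ⁻¹' A ⊆ h.flow t s '' A := fun x hx => ⟨_, hx, h.flow_inv s t x⟩
  refine (measure_mono h1).trans ((vol_image_le (h.flow_lip t s) A).trans ?_)
  simp [ENNReal.smul_def]

lemma map_flow_ac (h : GoodV Q v) (s t : ℝ) : volume.map (h.flow s t) ≪ (volume : Measure E3) :=
  (Measure.absolutelyContinuous_of_le (h.map_flow_le s t)).trans
    (Measure.smul_absolutelyContinuous)

instance sf (h : GoodV Q v) (s t : ℝ) : SigmaFinite (volume.map (h.flow s t)) :=
  (h.flowH s t).toMeasurableEquiv.sigmaFinite_map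

/-- Jacobian density of the flow. -/
def jac (h : GoodV Q v) (t : ℝ) : E3 → ENNReal := (volume.map (h.flow 0 t)).rnDeriv volume

lemma jac_le (h : GoodV Q v) (t : ℝ) :
    ∀ᵐ x, h.jac t x ≤ ((exp (Q * |t|)).toNNReal ^ 3 : NNReal) := by
  have := ae_le_of_forall_setLIntegral_le_of_sigmaFinite (μ := (volume : Measure E3)) (f := h.jac t)
    (g := fun _ => (((exp (Q * |t|)).toNNReal ^ 3 : NNReal) : ENNReal))
    (Measure.measurable_rnDeriv _ _) (fun s hs _ => ?_)
  · exact this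
  · refine (Measure.setLIntegral_rnDeriv_le s).trans ?_
    have := Measure.le_iff.1 (h.map_flow_le 0 t) s hs
    simpa [ENNReal.smul_def] using this

/-- Density transported by the flow. -/
def pf (h : GoodV Q v) (ρ₀ : E3 → ℝ) (t : ℝ) (x : E3) : ℝ :=
  (h.jac t x).toReal * ρ₀ (h.flow t 0 x)

lemma pf_integral (h : GoodV Q v) (ρ₀ : E3 → ℝ) (t : ℝ) (f : E3 → ℝ) :
    ∫ x, h.pf ρ₀ t x * f x = ∫ y, ρ₀ y * f (h.flow 0 t y) := by
  have h1 := integral_rnDeriv_smul (h.map_flow_ac 0 t) (f := fun x => ρ₀ (h.flow t 0 x) * f x)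
  rw [(h.flow_me 0 t).integral_map] at h1
  simp only [h.flow_inv] at h1
  rw [← h1]
  refine integral_congr_ae (Eventually.of_forall fun x => ?_)
  simp only [pf, jac, smul_eq_mul]
  ring

lemma pf_integrable (h : GoodV Q v) {ρ₀ : E3 → ℝ} (hρ : Integrable ρ₀) (t : ℝ) :
    Integrable (h.pf ρ₀ t) := by
  have h1 := (integrable_rnDeriv_smul_iff (h.map_flow_ac 0 t)
    (f := fun x => ρ₀ (h.flow t 0 x))).2 ?_
  · exact h1
  · rw [(h.flow_me 0 t).integrable_map_iff]
    refine hρ.congr (Eventually.of_forall fun x => ?_)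
    simp [h.flow_inv]

lemma pf_bdd (h : GoodV Q v) {ρ₀ : E3 → ℝ} {M T : ℝ} (hρ : ∀ᵐ x, |ρ₀ x| ≤ M) {t : ℝ}
    (ht : t ∈ Icc 0 T) : ∀ᵐ x, |h.pf ρ₀ t x| ≤ exp (Q * T) ^ 3 * M := by
  have h1 : ∀ᵐ x, |ρ₀ (h.flow t 0 x)| ≤ M :=
    ((⟨(h.flow_cont t 0).measurable, h.map_flow_ac t 0⟩ :
      Measure.QuasiMeasurePreserving (h.flow t 0) volume volume)).ae hρ
  filter_upwards [h1, h.jac_le t] with x hx hj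
  rw [pf, abs_mul, abs_of_nonneg ENNReal.toReal_nonneg]
  have h2 : (h.jac t x).toReal ≤ exp (Q * T) ^ 3 := by
    have h3 := ENNReal.toReal_mono (by simp) hj
    refine h3.trans ?_
    simp only [ENNReal.coe_toReal, NNReal.coe_pow]
    rw [Real.coe_toNNReal _ (exp_pos _).le, abs_of_nonneg ht.1]
    have := h.Q0
    have := ht.2
    gcongr
  gcongr

lemma pf_densM (h : GoodV Q v) {ρ₀ : E3 → ℝ} (hm : Measurable ρ₀) (t : ℝ) :
    densM (h.pf ρ₀ t) = (densM ρ₀).map (h.flow 0 t) := by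
  ext A hA
  rw [Measure.map_apply (h.flow_cont 0 t).measurable hA, densM, densM,
    withDensity_apply _ hA, withDensity_apply _ ((h.flow_cont 0 t).measurable hA)]
  have h1 : ∀ᵐ x ∂(volume.restrict A), ENNReal.ofReal (h.pf ρ₀ t x) =
      h.jac t x * ENNReal.ofReal (ρ₀ (h.flow t 0 x)) := by
    refine ae_restrict_of_ae ?_
    filter_upwards [h.jac_le t] with x hj
    rw [pf, ENNReal.ofReal_mul ENNReal.toReal_nonneg, ENNReal.ofReal_toReal]
    exact ne_top_of_le_ne_top (by simp) hj
  rw [lintegral_congr_ae h1]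
  have hm' : Measurable fun x => ENNReal.ofReal (ρ₀ (h.flow t 0 x)) :=
    (hm.comp (h.flow_cont t 0).measurable).ennreal_ofReal
  have h2 := setLIntegral_rnDeriv_mul (h.map_flow_ac 0 t) hm'.aemeasurable hA
  refine h2.trans ?_
  rw [(h.flow_me 0 t).restrict_map, (h.flow_me 0 t).lintegral_map]
  simp [h.flow_inv]

end GoodV

lemma chain_ac {F : Type*} [NormedAddCommGroup F] [NormedSpace ℝ F] [CompleteSpace F]
    {g : F → ℝ} (hg : ContDiff ℝ 1 g) {w ω : ℝ → F} {C : ℝ} (hw : Continuous w)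
    (hi : ∀ a b, IntervalIntegrable ω volume a b) (hC : ∀ τ, ‖ω τ‖ ≤ C)
    (hii : ∀ a b, IntervalIntegrable (fun τ => fderiv ℝ g (w τ) (ω τ)) volume a b)
    (e : ∀ a b, w b - w a = ∫ τ in a..b, ω τ) (a b : ℝ) :
    g (w b) = g (w a) + ∫ τ in a..b, fderiv ℝ g (w τ) (ω τ) := by
  set H : ℝ → ℝ := fun t => g (w t) - ∫ τ in a..t, fderiv ℝ g (w τ) (ω τ) with hH
  have hC0 : 0 ≤ C := (norm_nonneg _).trans (hC 0)
  have hwl : ∀ s t, ‖w t - w s‖ ≤ C * |t - s| := fun s t => by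
    rw [e s t]
    exact intervalIntegral.norm_integral_le_of_norm_le_const fun τ _ => hC τ
  have hd : ∀ t, HasDerivAt H 0 t := by
    intro t
    rw [hasDerivAt_iff_isLittleO]
    have hA : (fun y => g (w y) - g (w t) - fderiv ℝ g (w t) (w y - w t)) =o[𝓝 t]
        fun y => y - t := by
      have h1 := ((hg.differentiable one_ne_zero (w t)).hasFDerivAt.isLittleO).comp_tendsto
        (hw.tendsto t)
      refine h1.trans_isBigO ?_
      refine Asymptotics.IsBigO.of_bound C (Eventually.of_forall fun y => ?_)
      exact hwl t y
    have hB : (fun y => ∫ τ in t..y, (fderiv ℝ g (w τ) (ω τ) - fderiv ℝ g (w t) (ω τ))) =o[𝓝 t]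
        fun y => y - t := by
      rw [Asymptotics.isLittleO_iff]
      intro c hc
      have hcont : Continuous fun τ => fderiv ℝ g (w τ) :=
        (hg.continuous_fderiv one_ne_zero).comp hw
      have h1 : ∀ᶠ τ in 𝓝 t, ‖fderiv ℝ g (w τ) - fderiv ℝ g (w t)‖ < c / (C + 1) := by
        have := (hcont.sub continuous_const).norm.tendsto (x := t) (f := fun τ =>
          ‖fderiv ℝ g (w τ) - fderiv ℝ g (w t)‖)
        simp only [sub_self, norm_zero] at this
        exact this.eventually (gt_mem_nhds (by positivity))
      obtain ⟨δ, hδ, hb⟩ := Metric.eventually_nhds_iff.1 h1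
      filter_upwards [Metric.ball_mem_nhds t hδ] with y hy
      refine intervalIntegral.norm_integral_le_of_norm_le_const fun τ hτ => ?_
      have hτ' : dist τ t < δ := by
        rw [Real.dist_eq]
        have h2 : |τ - t| ≤ |y - t| := abs_sub_left_of_mem_uIcc (uIoc_subset_uIcc hτ)
        exact h2.trans_lt (by rwa [Metric.mem_ball, Real.dist_eq] at hy)
      have h3 := hb hτ'
      calc ‖fderiv ℝ g (w τ) (ω τ) - fderiv ℝ g (w t) (ω τ)‖
          = ‖(fderiv ℝ g (w τ) - fderiv ℝ g (w t)) (ω τ)‖ := by simp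
        _ ≤ ‖fderiv ℝ g (w τ) - fderiv ℝ g (w t)‖ * ‖ω τ‖ := ContinuousLinearMap.le_opNorm _ _
        _ ≤ c / (C + 1) * (C + 1) := by
            gcongr
            linarith [hC τ]
        _ = c := by field_simp
    refine (hA.sub hB).congr_left fun y => ?_
    have hii2 : IntervalIntegrable (fun τ => fderiv ℝ g (w t) (ω τ)) volume t y :=
      ⟨(fderiv ℝ g (w t)).integrable_comp (hi t y).1, (fderiv ℝ g (w t)).integrable_comp (hi t y).2⟩
    rw [intervalIntegral.integral_sub (hii t y) hii2, ContinuousLinearMap.intervalIntegral_comp_comm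
      _ (hi t y), ← e t y, hH]
    have := intervalIntegral.integral_add_adjacent_intervals (hii a t) (hii t y)
    simp only [← this, smul_zero]
    ring
  have h1 := is_const_of_deriv_eq_zero (fun t => (hd t).differentiableAt) (fun t => (hd t).deriv) b a
  simp only [hH, intervalIntegral.integral_same] at h1
  linarith

lemma dpsi {ψ : ℝ → E3 → ℝ} (hψ : ContDiff ℝ 1 (fun p : ℝ × E3 => ψ p.1 p.2)) (τ : ℝ) (x w : E3) :
    deriv (fun s => ψ s x) τ + ⟪w, gradient (ψ τ) x⟫ =
      fderiv ℝ (fun p : ℝ × E3 => ψ p.1 p.2) (τ, x) (1, w) := by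
  have hd := (hψ.differentiable one_ne_zero (τ, x)).hasFDerivAt
  have h1 : HasDerivAt (fun s => ψ s x)
      (fderiv ℝ (fun p : ℝ × E3 => ψ p.1 p.2) (τ, x) (1, 0)) τ :=
    HasFDerivAt.comp_hasDerivAt (f := fun s : ℝ => (s, x)) τ hd
      ((hasDerivAt_id τ).prodMk (hasDerivAt_const τ x))
  have h2 : HasFDerivAt (ψ τ) ((fderiv ℝ (fun p : ℝ × E3 => ψ p.1 p.2) (τ, x)).comp
      (ContinuousLinearMap.inr ℝ ℝ E3)) x :=
    hd.comp x (hasFDerivAt_prodMk_right τ x)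
  rw [h1.deriv, real_inner_comm, gradient, InnerProductSpace.toDual_symm_apply, h2.fderiv]
  simp only [ContinuousLinearMap.comp_apply, ContinuousLinearMap.inr_apply]
  rw [← map_add]
  simp

namespace GoodV
variable {Q : ℝ} {v : ℝ → E3 → E3}

lemma fd_meas {F : ℝ × E3 → ℝ} (hF : ContDiff ℝ 1 F) {X : Type*} [MeasurableSpace X]
    {a : X → ℝ} {b c : X → E3} (ha : Measurable a) (hb : Measurable b) (hc : Measurable c) :
    Measurable fun p => fderiv ℝ F (a p, b p) (1, c p) := by
  have h1 : Continuous fun q : (ℝ × E3) × (ℝ × E3) => fderiv ℝ F q.1 q.2 :=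
    ((hF.continuous_fderiv one_ne_zero).comp continuous_fst).clm_apply continuous_snd
  exact h1.measurable.comp ((ha.prodMk hb).prodMk (measurable_const.prodMk hc))

lemma fd_bdd (h : GoodV Q v) {F : ℝ × E3 → ℝ} {C : ℝ}
    (hC : ∀ p, ‖fderiv ℝ F p‖ ≤ C) (t : ℝ) (x y : E3) :
    ‖fderiv ℝ F (t, x) (1, v t y)‖ ≤ C * (1 + Q) := by
  have hC0 : 0 ≤ C := (norm_nonneg _).trans (hC 0)
  refine (ContinuousLinearMap.le_opNorm _ _).trans ?_
  gcongr
  · exact hC _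
  · rw [Prod.norm_def]
    have := h.bdd t y
    have := h.Q0
    simp only [norm_one]
    exact max_le (by linarith) (by linarith)

lemma traj_chain (h : GoodV Q v) {F : ℝ × E3 → ℝ} (hF : ContDiff ℝ 1 F)
    (hs : HasCompactSupport F) {z : ℝ → E3} (hz : IsTraj v z) (a b : ℝ) :
    F (b, z b) = F (a, z a) + ∫ τ in a..b, fderiv ℝ F (τ, z τ) (1, v τ (z τ)) := by
  have hzc := hz.1
  obtain ⟨C, hC⟩ := (hF.continuous_fderiv one_ne_zero).bounded_above_of_compact_support
    (hs.fderiv (𝕜 := ℝ))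
  have hv := h.measC hzc.measurable
  refine chain_ac (C := 1 + Q) hF (w := fun τ => (τ, z τ)) (ω := fun τ => (1, v τ (z τ))) (by fun_prop)
    ?_ ?_ ?_ ?_ a b
  · intro a b
    exact ⟨(intervalIntegrable_const (c := (1:ℝ))).1.prodMk (h.ii hzc.measurable a b).1,
      (intervalIntegrable_const (c := (1:ℝ))).2.prodMk (h.ii hzc.measurable a b).2⟩
  · intro τ
    rw [Prod.norm_def]
    have := h.bdd τ (z τ)
    have := h.Q0
    simp only [norm_one]
    exact max_le (by linarith) (by linarith)
  · intro a b
    refine (intervalIntegrable_const (c := C * (1 + Q))).mono_fun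
      (fd_meas hF measurable_id hzc.measurable hv).aestronglyMeasurable
      (Eventually.of_forall fun τ => ?_)
    exact (h.fd_bdd hC _ _ _).trans (le_abs_self _)
  · intro a b
    have h1 : IntervalIntegrable (fun τ => ((1:ℝ), v τ (z τ))) volume a b :=
      ⟨(intervalIntegrable_const (c := (1:ℝ))).1.prodMk (h.ii hzc.measurable a b).1,
      (intervalIntegrable_const (c := (1:ℝ))).2.prodMk (h.ii hzc.measurable a b).2⟩
    have h2 := ContinuousLinearMap.intervalIntegral_comp_comm (ContinuousLinearMap.fst ℝ ℝ E3) h1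
    have h3 := ContinuousLinearMap.intervalIntegral_comp_comm (ContinuousLinearMap.snd ℝ ℝ E3) h1
    simp only [ContinuousLinearMap.coe_fst', ContinuousLinearMap.coe_snd'] at h2 h3
    refine Prod.ext ?_ ?_
    · rw [← h2]; simp
    · rw [← h3, ← hz.2 a b]; rfl

lemma pf_sol (h : GoodV Q v) {ρ₀ : E3 → ℝ} (hρ : Integrable ρ₀) (T : ℝ) :
    IsTransportSol T v ρ₀ (h.pf ρ₀) := by
  intro ψ hψ hs t ht
  have hψ1 : ContDiff ℝ 1 (fun p : ℝ × E3 => ψ p.1 p.2) := hψ.of_le (by exact_mod_cast le_top)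
  set F : ℝ × E3 → ℝ := fun p => ψ p.1 p.2 with hF
  obtain ⟨C, hC⟩ := (hψ1.continuous_fderiv one_ne_zero).bounded_above_of_compact_support
    (hs.fderiv (𝕜 := ℝ))
  obtain ⟨C', hC'⟩ := hψ1.continuous.bounded_above_of_compact_support hs
  simp only [dpsi hψ1, h.pf_integral]
  have hXm := h.flow_meas 0
  have hG : Measurable fun p : ℝ × E3 =>
      fderiv ℝ F (p.1, h.flow 0 p.1 p.2) (1, v p.1 (h.flow 0 p.1 p.2)) :=
    fd_meas hψ1 measurable_fst hXm (h.measU.comp (measurable_fst.prodMk hXm))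
  have hIntg : Integrable (fun p : ℝ × E3 => ρ₀ p.2 *
      fderiv ℝ F (p.1, h.flow 0 p.1 p.2) (1, v p.1 (h.flow 0 p.1 p.2)))
      ((volume.restrict (Ioc 0 t)).prod volume) :=
    (hρ.comp_snd _).mul_bdd (c := C * (1 + Q)) hG.aestronglyMeasurable
      (Eventually.of_forall fun p => h.fd_bdd hC _ _ _)
  rw [intervalIntegral.integral_of_le ht.1, integral_integral_swap hIntg, ← integral_add]
  · refine integral_congr_ae (Eventually.of_forall fun y => ?_)
    have h1 := h.traj_chain hψ1 hs (h.flow_traj 0 y) 0 t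
    simp only [hF, h.flow_self] at h1
    simp only
    rw [h1, integral_const_mul, intervalIntegral.integral_of_le ht.1]
    ring
  · refine hρ.mul_bdd (c := C') ?_ (Eventually.of_forall fun y => hC' (0, y))
    exact (hψ1.continuous.comp (Continuous.prodMk_right (0:ℝ))).aestronglyMeasurable
  · exact hIntg.swap.integral_prod_left

end GoodV

lemma sol_congr {T : ℝ} {u u' : ℝ → E3 → E3} {ρ₀ ρ₀' : E3 → ℝ} {ρ ρ' : ℝ → E3 → ℝ}
    (h : IsTransportSol T u ρ₀ ρ) (hu : ∀ᵐ t ∂(volume.restrict (Icc 0 T)), u t = u' t)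
    (h0 : ρ₀ =ᵐ[volume] ρ₀') (hρ : ∀ t ∈ Icc 0 T, ρ t =ᵐ[volume] ρ' t) :
    IsTransportSol T u' ρ₀' ρ' := by
  intro ψ hψ hs t ht
  have h1 := h ψ hψ hs t ht
  have e1 : ∫ x, ρ t x * ψ t x = ∫ x, ρ' t x * ψ t x :=
    integral_congr_ae (by filter_upwards [hρ t ht] with x hx; rw [hx])
  have e2 : ∫ x, ρ₀ x * ψ 0 x = ∫ x, ρ₀' x * ψ 0 x :=
    integral_congr_ae (by filter_upwards [h0] with x hx; rw [hx])
  rw [← e1, ← e2, h1]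
  congr 1
  refine intervalIntegral.integral_congr_ae ?_
  rw [ae_restrict_iff' measurableSet_Icc] at hu
  filter_upwards [hu] with τ hτ hτ'
  rw [uIoc_of_le ht.1] at hτ'
  have hm : τ ∈ Icc 0 T := ⟨hτ'.1.le, hτ'.2.trans ht.2⟩
  rw [hτ hm]
  exact integral_congr_ae (by filter_upwards [hρ τ hm] with x hx; rw [hx])

lemma sol_zero {T : ℝ} (hT : 0 < T) {u : ℝ → E3 → E3} {ρ₀ : E3 → ℝ} {ρ : ℝ → E3 → ℝ}
    (h : IsTransportSol T u ρ₀ ρ) : IsTransportSol T u (ρ 0) ρ := by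
  intro ψ hψ hs t ht
  have h1 := h ψ hψ hs 0 ⟨le_rfl, hT.le⟩
  rw [intervalIntegral.integral_same, add_zero] at h1
  rw [h1]
  exact h ψ hψ hs t ht

lemma test_id {T : ℝ} (hT : 0 < T) {u : ℝ → E3 → E3} {ρ₀ : E3 → ℝ} {ρ : ℝ → E3 → ℝ}
    (h : IsTransportSol T u ρ₀ ρ) (φ : ContDiffBump (0 : E3)) {z : ℝ → E3}
    (hz : ContDiff ℝ (⊤ : ℕ∞) z) {t : ℝ} (ht : t ∈ Icc 0 T) :
    ∫ y, ρ t y * φ (z t - y) = (∫ y, ρ₀ y * φ (z 0 - y)) +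
      ∫ τ in (0:ℝ)..t, ∫ y, ρ τ y * fderiv ℝ φ (z τ - y) (deriv z τ - u τ y) := by
  let χ : ContDiffBump (0 : ℝ) := ⟨T + 1, T + 2, by linarith, by linarith⟩
  have hχ : ∀ τ ∈ Icc 0 T, ∀ᶠ s in 𝓝 τ, χ s = 1 := fun τ hτ => by
    have := χ.eventuallyEq_one_of_mem_ball (x := τ) (by
      rw [Metric.mem_ball, Real.dist_eq, sub_zero, abs_of_nonneg hτ.1]
      change τ < T + 1
      linarith [hτ.2])
    exact this
  have hχ1 : ∀ τ ∈ Icc 0 T, χ τ = 1 := fun τ hτ => (hχ τ hτ).self_of_nhds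
  have hφ : ContDiff ℝ (⊤ : ℕ∞) φ := φ.contDiff
  have hd : Differentiable ℝ φ := hφ.differentiable (by simp)
  have h1 := h (fun τ y => χ τ * φ (z τ - y)) ?_ ?_ t ht
  · have h0 : (0:ℝ) ∈ Icc 0 T := ⟨le_rfl, hT.le⟩
    simp only [hχ1 t ht, hχ1 0 h0, one_mul] at h1
    rw [h1]
    congr 1
    refine intervalIntegral.integral_congr fun τ hτ => ?_
    rw [uIcc_of_le ht.1] at hτ
    have hτ' : τ ∈ Icc 0 T := ⟨hτ.1, hτ.2.trans ht.2⟩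
    refine integral_congr_ae (Eventually.of_forall fun y => ?_)
    simp only
    congr 1
    have e1 : deriv (fun s => χ s * φ (z s - y)) τ = fderiv ℝ φ (z τ - y) (deriv z τ) := by
      have : (fun s => χ s * φ (z s - y)) =ᶠ[𝓝 τ] fun s => φ (z s - y) := by
        filter_upwards [hχ τ hτ'] with s hs
        rw [hs, one_mul]
      rw [this.deriv_eq]
      have hz' : HasDerivAt (fun s => z s - y) (deriv z τ) τ :=
        ((hz.differentiable (by simp) τ).hasDerivAt).sub_const y
      exact (HasFDerivAt.comp_hasDerivAt (f := fun s => z s - y) τ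
        (hd (z τ - y)).hasFDerivAt hz').deriv
    have e2 : ⟪u τ y, gradient (fun y => φ (z τ - y)) y⟫ = -fderiv ℝ φ (z τ - y) (u τ y) := by
      have hz' : HasFDerivAt (fun y => z τ - y) (-ContinuousLinearMap.id ℝ E3) y :=
        (hasFDerivAt_id y).const_sub (z τ)
      have := (HasFDerivAt.comp y (f := fun y => z τ - y) (hd (z τ - y)).hasFDerivAt hz')
      rw [real_inner_comm, gradient, InnerProductSpace.toDual_symm_apply]
      have e : (fun y => φ (z τ - y)) = (φ ∘ fun y => z τ - y) := rfl
      rw [e, this.fderiv]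
      simp
    simp only [hχ1 τ hτ', one_mul]
    rw [e1, e2, map_sub]
    ring
  · have hχs : ContDiff ℝ (⊤ : ℕ∞) χ := χ.contDiff
    exact (hχs.comp contDiff_fst).mul (hφ.comp ((hz.comp contDiff_fst).sub contDiff_snd))
  · have hc : Continuous fun q : ℝ × E3 => (q.1, z q.1 - q.2) := by
      have := hz.continuous
      fun_prop
    refine HasCompactSupport.intro (((isCompact_closedBall (0:ℝ) χ.rOut).prod
      (isCompact_closedBall (0:E3) φ.rOut)).image hc) fun p hp => ?_
    by_contra hne
    have hA := left_ne_zero_of_mul hne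
    have hB := right_ne_zero_of_mul hne
    refine hp ⟨(p.1, z p.1 - p.2), ⟨?_, ?_⟩, by simp⟩
    · by_contra hn
      exact hA (χ.zero_of_le_dist (le_of_lt (by simpa using hn)))
    · by_contra hn
      exact hB (φ.zero_of_le_dist (le_of_lt (by simpa using hn)))

lemma prim_meas {F f : ℝ → ℝ} {T c : ℝ} (hf : ∀ t ∈ Icc 0 T, f t = c + ∫ τ in (0:ℝ)..t, F τ) :
    Measurable ((Icc 0 T).indicator f) := by
  classical
  set S : Set ℝ := {t | t ∈ Icc 0 T ∧ IntervalIntegrable F volume 0 t} with hS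
  have hdown : ∀ t ∈ S, ∀ s ∈ Icc 0 t, s ∈ S := fun t ht s hs =>
    ⟨⟨hs.1, hs.2.trans ht.1.2⟩, ht.2.mono_set (by
      rw [uIcc_of_le hs.1, uIcc_of_le (hs.1.trans hs.2)]; exact Icc_subset_Icc_right hs.2)⟩
  have hSm : MeasurableSet S := by
    refine OrdConnected.measurableSet ⟨fun x hx y hy z hz => hdown y hy z ⟨hx.1.1.trans hz.1, hz.2⟩⟩
  have hcont : ContinuousOn f S := by
    have hIcc : ∀ t ∈ S, ContinuousOn f (Icc 0 t) := fun t ht => by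
      have h1 := intervalIntegral.continuousOn_primitive_interval' ht.2 (left_mem_uIcc)
      rw [uIcc_of_le ht.1.1] at h1
      refine (h1.const_add c).congr fun s hs => hf s (hdown t ht s hs).1
    intro t ht
    by_cases hmax : ∃ t' ∈ S, t < t'
    · obtain ⟨t', ht', hlt⟩ := hmax
      have h1 := hIcc t' ht' t ⟨ht.1.1, hlt.le⟩
      refine h1.mono_of_mem_nhdsWithin ?_
      have : Iio t' ∈ 𝓝 t := Iio_mem_nhds hlt
      refine mem_nhdsWithin.2 ⟨Iio t', isOpen_Iio, hlt, fun s hs => ⟨hs.2.1.1, le_of_lt hs.1⟩⟩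
    · push Not at hmax
      exact (hIcc t ht t ⟨ht.1.1, le_rfl⟩).mono fun s hs => ⟨hs.1.1, hmax s hs⟩
  have h1 : (Icc 0 T).indicator f = (Icc 0 T).indicator (S.piecewise f (fun _ => c)) := by
    ext1 t
    by_cases ht : t ∈ Icc 0 T
    · rw [indicator_of_mem ht, indicator_of_mem ht]
      by_cases htS : t ∈ S
      · rw [piecewise_eq_of_mem _ _ _ htS]
      · rw [piecewise_eq_of_notMem _ _ _ htS, hf t ht, intervalIntegral.integral_undef, add_zero]
        exact fun hi => htS ⟨ht, hi⟩
    · rw [indicator_of_notMem ht, indicator_of_notMem ht]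
  rw [h1]
  exact (hcont.measurable_piecewise continuousOn_const hSm).indicator measurableSet_Icc

/-- A sequence of bump functions shrinking to the origin. -/
def bmp (n : ℕ) : ContDiffBump (0 : E3) :=
  ⟨((n : ℝ) + 1)⁻¹, 2 * ((n : ℝ) + 1)⁻¹, by positivity, by
    have : (0:ℝ) < ((n : ℝ) + 1)⁻¹ := by positivity
    linarith⟩

lemma bmp_scale (n : ℕ) (x : E3) : bmp n x = bmp 0 (((n : ℝ) + 1) • x) := by
  have h : (0:ℝ) < (n : ℝ) + 1 := by positivity
  rw [ContDiffBump.apply, ContDiffBump.apply]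
  congr 1
  · simp only [bmp]; field_simp
  · simp [bmp]

lemma bmp_ip (n : ℕ) : 0 < ∫ x, bmp n x := (bmp n).integral_pos

lemma bmp_tendsto {g : E3 → ℝ} (hg : LocallyIntegrable g) :
    ∀ᵐ x, Tendsto (fun n => (∫ y, g y * bmp n (x - y)) / ∫ y, bmp n y) atTop (𝓝 (g x)) := by
  have := ContDiffBump.ae_convolution_tendsto_right_of_locallyIntegrable (φ := bmp) (l := atTop)
    (K := 2) (μ := (volume : Measure E3)) (g := g) ?_ (Eventually.of_forall fun n => le_rfl) hg
  · filter_upwards [this] with x hx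
    refine hx.congr fun n => ?_
    rw [convolution_eq_swap, ← integral_div]
    refine integral_congr_ae (Eventually.of_forall fun y => ?_)
    simp only [ContDiffBump.normed, ContinuousLinearMap.lsmul_apply, smul_eq_mul]
    ring
  · have h1 : Tendsto (fun n : ℕ => 2 * ((n : ℝ) + 1)⁻¹) atTop (𝓝 (2 * 0)) := by
      refine Tendsto.const_mul 2 ?_
      simpa [one_div] using tendsto_one_div_add_atTop_nhds_zero_nat (𝕜 := ℝ)
    rw [mul_zero] at h1
    exact h1

lemma bmp_fderiv (n : ℕ) (x : E3) :
    fderiv ℝ (bmp n) x = ((n : ℝ) + 1) • fderiv ℝ (bmp 0) (((n : ℝ) + 1) • x) := by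
  have hd : Differentiable ℝ (bmp 0) := (bmp 0).contDiff.differentiable (n := 1) (by simp)
  have e : (bmp n : E3 → ℝ) = fun x => bmp 0 (((n : ℝ) + 1) • x) := funext (bmp_scale n)
  rw [e]
  have := HasFDerivAt.comp x (f := fun x : E3 => ((n : ℝ) + 1) • x)
    (hd (((n : ℝ) + 1) • x)).hasFDerivAt ((hasFDerivAt_id x).const_smul ((n : ℝ) + 1))
  refine this.fderiv.trans ?_
  ext w
  simp

/-- The scale invariant constant attached to the bump functions. -/
def bK : ℝ := (∫ w, ‖fderiv ℝ (bmp 0) w‖ * ‖w‖) / ∫ w, bmp 0 w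

lemma bK_nonneg : 0 ≤ bK := div_nonneg (integral_nonneg fun w => by positivity) (bmp_ip 0).le

lemma bK_eq (n : ℕ) : ∫ w, ‖fderiv ℝ (bmp n) w‖ * ‖w‖ = bK * ∫ w, bmp n w := by
  have h : (0:ℝ) < (n : ℝ) + 1 := by positivity
  have e1 : ∫ w, bmp n w = ∫ w, bmp 0 (((n : ℝ) + 1) • w) := by simp_rw [bmp_scale n]
  have e2 : ∫ w, ‖fderiv ℝ (bmp n) w‖ * ‖w‖ =
      ∫ w : E3, (fun w => ‖fderiv ℝ (bmp 0) w‖ * ‖w‖) (((n : ℝ) + 1) • w) := by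
    refine integral_congr_ae (Eventually.of_forall fun w => ?_)
    simp only [bmp_fderiv n w, norm_smul, norm_of_nonneg h.le]
    ring
  rw [e1, e2, Measure.integral_comp_smul volume (fun w : E3 => ‖fderiv ℝ (bmp 0) w‖ * ‖w‖)
    ((n : ℝ) + 1), Measure.integral_comp_smul, bK]
  have := (bmp_ip 0).ne'
  simp only [smul_eq_mul]
  field_simp

lemma bmp_fc (n : ℕ) : Continuous (fderiv ℝ (bmp n)) :=
  ((bmp n).contDiff (n := 1)).continuous_fderiv one_ne_zero

lemma bmp_fs (n : ℕ) : HasCompactSupport (fderiv ℝ (bmp n)) :=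
  (bmp n).hasCompactSupport.fderiv (𝕜 := ℝ)

lemma bmp_i1 (n : ℕ) : Integrable (fun w => ‖fderiv ℝ (bmp n) w‖) :=
  (bmp_fc n).norm.integrable_of_hasCompactSupport (bmp_fs n).norm

lemma bmp_i2 (n : ℕ) : Integrable (fun w => ‖fderiv ℝ (bmp n) w‖ * ‖w‖) :=
  ((bmp_fc n).norm.mul continuous_norm).integrable_of_hasCompactSupport (bmp_fs n).norm.mul_right

lemma jm {T : ℝ} (hT : 0 < T) {u : ℝ → E3 → E3} {ρ₀ : E3 → ℝ} {ρ : ℝ → E3 → ℝ}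
    (h : IsTransportSol T u ρ₀ ρ) (hρ : InL1Linfty T ρ) :
    ∃ σ : ℝ → E3 → ℝ, Measurable (fun p : ℝ × E3 => σ p.1 p.2) ∧
      ∀ t ∈ Icc 0 T, ρ t =ᵐ[volume] σ t := by
  classical
  obtain ⟨M, hM⟩ := hρ
  let r : ℕ → E3 → ℝ → ℝ := fun n x => (Icc 0 T).indicator fun t =>
    (∫ y, ρ t y * bmp n (x - y)) / ∫ y, bmp n y
  have hr1 : ∀ n x, Measurable (r n x) := fun n x => by
    have := prim_meas (T := T) (f := fun t => ∫ y, ρ t y * bmp n (x - y)) (fun t ht =>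
      test_id hT h (bmp n) (z := fun _ => x) contDiff_const ht)
    have h2 := this.div_const (∫ y, bmp n y)
    convert h2 using 1
    ext1 t
    by_cases ht : t ∈ Icc 0 T <;> simp [r, ht]
  have hr2 : ∀ n t, Continuous fun x => r n x t := fun n t => by
    by_cases ht : t ∈ Icc 0 T
    · have h1 := (bmp n).hasCompactSupport.continuous_convolution_left
        (ContinuousLinearMap.lsmul ℝ ℝ) (bmp n).continuous
        (hM t ht).1.locallyIntegrable (μ := volume)
      have h2 := h1.div_const (∫ y, bmp n y)
      refine h2.congr fun x => ?_
      simp only [r, indicator_of_mem ht]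
      rw [convolution_eq_swap]
      congr 1
      refine integral_congr_ae (Eventually.of_forall fun y => ?_)
      simp only [ContinuousLinearMap.lsmul_apply, smul_eq_mul]
      ring
    · simp only [r, indicator_of_notMem ht]
      exact continuous_const
  refine ⟨fun t x => limsup (fun n => r n x t) atTop, ?_, ?_⟩
  · refine Measurable.limsup (f := fun n (p : ℝ × E3) => r n p.2 p.1) fun n => ?_
    have := measurable_uncurry_of_continuous_of_measurable (u := r n) (hr2 n) (hr1 n)
    exact this.comp measurable_swap
  · intro t ht
    filter_upwards [bmp_tendsto (hM t ht).1.locallyIntegrable] with x hx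
    symm
    apply Tendsto.limsup_eq
    simpa only [r, indicator_of_mem ht] using hx

lemma GoodV.approx {Q : ℝ} {v : ℝ → E3 → E3} (h : GoodV Q v) {T t : ℝ} (ht : t ∈ Icc 0 T) (x : E3)
    {δ : ℝ} (hδ : 0 < δ) : ∃ z : ℝ → E3, ContDiff ℝ (⊤ : ℕ∞) z ∧ z t = x ∧
      ∫ τ in (0:ℝ)..t, ‖deriv z τ - v τ (z τ)‖ ≤ δ := by
  obtain ⟨X, hX, hXt⟩ := h.exists_traj t x
  have hXm := hX.1.measurable
  have hQ := h.Q0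
  have ht0 := ht.1
  set ε := δ / (1 + Q * t) with hε
  have hε0 : 0 < ε := by positivity
  set g : ℝ → E3 := (Ioc 0 t).indicator fun τ => v τ (X τ) with hg
  have hgi : Integrable g := by
    rw [hg, integrable_indicator_iff measurableSet_Ioc]
    exact (h.ii hXm 0 t).1
  obtain ⟨p, hps, hpc, hpε⟩ := (memLp_one_iff_integrable.2 hgi).exist_eLpNorm_sub_le
    ENNReal.one_ne_top le_rfl hε0
  have hpi : Integrable p := hpc.continuous.integrable_of_hasCompactSupport hps
  have hgp : ∫ τ, ‖g τ - p τ‖ ≤ ε := by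
    have := (hgi.sub hpi)
    rw [eLpNorm_one_eq_lintegral_enorm] at hpε
    change ∫ τ, ‖(g - p) τ‖ ≤ ε
    rw [integral_norm_eq_lintegral_enorm this.aestronglyMeasurable]
    exact ENNReal.toReal_le_of_le_ofReal hε0.le hpε
  have hni : Integrable fun τ => ‖g τ - p τ‖ := (hgi.sub hpi).norm
  set z : ℝ → E3 := fun τ => x + ∫ r in t..τ, p r with hz
  have hzd : ∀ τ, HasDerivAt z (p τ) τ := fun τ =>
    (intervalIntegral.integral_hasDerivAt_right (hpc.continuous.intervalIntegrable _ _)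
      (hpc.continuous.stronglyMeasurableAtFilter _ _) hpc.continuous.continuousAt).const_add x
  have hzd' : deriv z = p := funext fun τ => (hzd τ).deriv
  have hzc : ContDiff ℝ (⊤ : ℕ∞) z := by
    rw [contDiff_infty_iff_deriv, hzd']
    exact ⟨fun τ => (hzd τ).differentiableAt, hpc⟩
  refine ⟨z, hzc, by simp [hz], ?_⟩
  have hzX : ∀ τ ∈ Icc 0 t, ‖z τ - X τ‖ ≤ ε := fun τ hτ => by
    have e1 : z τ - X τ = ∫ r in τ..t, (v r (X r) - p r) := by
      rw [intervalIntegral.integral_sub (h.ii hXm _ _) (hpc.continuous.intervalIntegrable _ _),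
        ← hX.2 τ t, hXt]
      change x + (∫ r in t..τ, p r) - X τ = _
      rw [intervalIntegral.integral_symm τ t]
      abel
    rw [e1]
    have e2 : ∫ r in τ..t, (v r (X r) - p r) = ∫ r in τ..t, (g r - p r) := by
      refine intervalIntegral.integral_congr_ae (Eventually.of_forall fun r hr => ?_)
      rw [uIoc_of_le hτ.2] at hr
      rw [hg, indicator_of_mem (show r ∈ Ioc 0 t from ⟨hτ.1.trans_lt hr.1, hr.2⟩)]
    rw [e2, intervalIntegral.integral_of_le hτ.2]
    refine (norm_integral_le_integral_norm _).trans (le_trans ?_ hgp)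
    exact setIntegral_le_integral hni (Eventually.of_forall fun _ => norm_nonneg _)
  have hle : ∀ τ ∈ Ioc 0 t, ‖deriv z τ - v τ (z τ)‖ ≤ ‖g τ - p τ‖ + Q * ε := fun τ hτ => by
    rw [hzd']
    have e1 : p τ - v τ (z τ) = -(g τ - p τ) + (v τ (X τ) - v τ (z τ)) := by
      rw [hg, indicator_of_mem hτ]; abel
    rw [e1]
    refine (norm_add_le _ _).trans ?_
    rw [norm_neg]
    gcongr
    refine (h.lip _ _ _).trans ?_
    rw [norm_sub_rev]
    gcongr
    exact hzX τ ⟨hτ.1.le, hτ.2⟩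
  have hb : ‖∫ τ in (0:ℝ)..t, ‖deriv z τ - v τ (z τ)‖‖ ≤ ∫ τ in (0:ℝ)..t, (‖g τ - p τ‖ + Q * ε) := by
    refine intervalIntegral.norm_integral_le_of_norm_le ht0 (Eventually.of_forall fun τ hτ => ?_) ?_
    · rw [norm_norm]; exact hle τ hτ
    · exact hni.intervalIntegrable.add intervalIntegrable_const
  refine (le_abs_self _).trans (hb.trans ?_)
  rw [intervalIntegral.integral_add hni.intervalIntegrable intervalIntegrable_const,
    intervalIntegral.integral_const, intervalIntegral.integral_of_le ht0]
  have h3 : ∫ τ in Ioc 0 t, ‖g τ - p τ‖ ≤ ε :=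
    (setIntegral_le_integral hni (Eventually.of_forall fun _ => norm_nonneg _)).trans hgp
  have h4 : ε + t * (Q * ε) = δ := by
    rw [hε]; field_simp
  simp only [smul_eq_mul, sub_zero]
  linarith

lemma fdb_meas (n : ℕ) {X : Type*} [MeasurableSpace X] {a b : X → E3} (ha : Measurable a)
    (hb : Measurable b) : Measurable fun p => fderiv ℝ (bmp n) (a p) (b p) := by
  have hc : Continuous fun q : E3 × E3 => fderiv ℝ (bmp n) q.1 q.2 :=
    isBoundedBilinearMap_apply.continuous.comp
      (((bmp_fc n).comp continuous_fst).prodMk continuous_snd)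
  exact hc.measurable.comp (ha.prodMk hb)

namespace GoodV
variable {Q : ℝ} {v : ℝ → E3 → E3}

lemma k_bd (h : GoodV Q v) (n : ℕ) {g : E3 → ℝ} {m : ℝ} (τ : ℝ)
    (hg : ∀ᵐ y, |g y| ≤ m) (w a : E3) : ∀ᵐ y,
      ‖g y * fderiv ℝ (bmp n) (w - y) (a - v τ y)‖ ≤
        m * (‖a - v τ w‖ * ‖fderiv ℝ (bmp n) (w - y)‖ +
          Q * (‖fderiv ℝ (bmp n) (w - y)‖ * ‖w - y‖)) := by
  filter_upwards [hg] with y hy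
  rw [norm_mul, Real.norm_eq_abs]
  refine mul_le_mul hy ?_ (norm_nonneg _) ((abs_nonneg _).trans hy)
  refine (ContinuousLinearMap.le_opNorm _ _).trans ?_
  have e : ‖a - v τ y‖ ≤ ‖a - v τ w‖ + Q * ‖w - y‖ := by
    have : a - v τ y = (a - v τ w) + (v τ w - v τ y) := by abel
    rw [this]
    refine (norm_add_le _ _).trans ?_
    gcongr
    exact h.lip _ _ _
  calc _ ≤ ‖fderiv ℝ (bmp n) (w - y)‖ * (‖a - v τ w‖ + Q * ‖w - y‖) := by gcongr
    _ = _ := by ring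

lemma k_maj (n : ℕ) (m c : ℝ) (w : E3) : Integrable fun y : E3 =>
        m * (c * ‖fderiv ℝ (bmp n) (w - y)‖ +
          Q * (‖fderiv ℝ (bmp n) (w - y)‖ * ‖w - y‖)) :=
  ((((bmp_i1 n).comp_sub_left w).const_mul c).add
    (((bmp_i2 n).comp_sub_left w).const_mul Q)).const_mul m

lemma k_int (h : GoodV Q v) (n : ℕ) {g : E3 → ℝ} {m : ℝ} (τ : ℝ) (hgm : Measurable g)
    (hg : ∀ᵐ y, |g y| ≤ m) (w a : E3) :
    Integrable fun y => g y * fderiv ℝ (bmp n) (w - y) (a - v τ y) :=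
  (k_maj (Q := Q) n m ‖a - v τ w‖ w).mono' (hgm.mul (fdb_meas n (by fun_prop)
    (measurable_const.sub (h.cont τ).measurable))).aestronglyMeasurable (h.k_bd n τ hg w a)

lemma k_norm (h : GoodV Q v) (n : ℕ) {g : E3 → ℝ} {m : ℝ} (τ : ℝ)
    (hg : ∀ᵐ y, |g y| ≤ m) (w a : E3) :
    ‖∫ y, g y * fderiv ℝ (bmp n) (w - y) (a - v τ y)‖ ≤
      m * (‖a - v τ w‖ * (∫ y, ‖fderiv ℝ (bmp n) y‖) + Q * (bK * ∫ y, bmp n y)) := by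
  refine (norm_integral_le_of_norm_le (k_maj (Q := Q) n m _ w) (h.k_bd n τ hg w a)).trans_eq ?_
  rw [integral_const_mul, integral_add (((bmp_i1 n).comp_sub_left w).const_mul _)
    (((bmp_i2 n).comp_sub_left w).const_mul Q), integral_const_mul, integral_const_mul,
    integral_sub_left_eq_self (fun y => ‖fderiv ℝ (bmp n) y‖) volume w,
    integral_sub_left_eq_self (fun y => ‖fderiv ℝ (bmp n) y‖ * ‖y‖) volume w, bK_eq]

lemma k_ii (h : GoodV Q v) (n : ℕ) {ρ : ℝ → E3 → ℝ} {M T : ℝ}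
    (hm : Measurable fun p : ℝ × E3 => ρ p.1 p.2)
    (hM : ∀ t ∈ Icc 0 T, ∀ᵐ x, |ρ t x| ≤ M) {z : ℝ → E3} (hz : ContDiff ℝ (⊤ : ℕ∞) z)
    {t : ℝ} (ht : t ∈ Icc 0 T) :
    IntervalIntegrable (fun τ => ∫ y, ρ τ y * fderiv ℝ (bmp n) (z τ - y) (deriv z τ - v τ y))
      volume 0 t := by
  have hzc := hz.continuous
  have hdc : Continuous (deriv z) := hz.continuous_deriv (by simp)
  rw [intervalIntegrable_iff_integrableOn_Ioc_of_le ht.1]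
  have hmeas : Measurable fun p : ℝ × E3 =>
      ρ p.1 p.2 * fderiv ℝ (bmp n) (z p.1 - p.2) (deriv z p.1 - v p.1 p.2) :=
    hm.mul (fdb_meas n ((hzc.measurable.comp measurable_fst).sub measurable_snd)
      ((hdc.measurable.comp measurable_fst).sub h.measU))
  have hsm : StronglyMeasurable fun τ =>
      ∫ y, ρ τ y * fderiv ℝ (bmp n) (z τ - y) (deriv z τ - v τ y) :=
    StronglyMeasurable.integral_prod_right (f := fun τ y =>
      ρ τ y * fderiv ℝ (bmp n) (z τ - y) (deriv z τ - v τ y)) hmeas.stronglyMeasurable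
  have hgi : IntegrableOn (fun τ => M * ((‖deriv z τ‖ + Q) * (∫ y, ‖fderiv ℝ (bmp n) y‖) +
      Q * (bK * ∫ y, bmp n y))) (Ioc 0 t) := by
    refine (Continuous.integrableOn_Icc ?_).mono_set Ioc_subset_Icc_self
    fun_prop
  refine Integrable.mono' hgi hsm.aestronglyMeasurable ?_
  filter_upwards [ae_restrict_mem measurableSet_Ioc] with τ hτ
  have hτ' : τ ∈ Icc 0 T := ⟨hτ.1.le, hτ.2.trans ht.2⟩
  refine (h.k_norm n τ (hM τ hτ') (z τ) (deriv z τ)).trans ?_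
  have hM0 : 0 ≤ M := by
    obtain ⟨x, hx⟩ := (hM τ hτ').exists
    exact (abs_nonneg _).trans hx
  have hL : 0 ≤ ∫ y, ‖fderiv ℝ (bmp n) y‖ := integral_nonneg fun _ => norm_nonneg _
  gcongr
  exact (norm_sub_le _ _).trans (add_le_add le_rfl (h.bdd _ _))

lemma diff_id (h : GoodV Q v) {T : ℝ} (hT : 0 < T) {ρ ρ' : ℝ → E3 → ℝ} {ρ₀ : E3 → ℝ} {M : ℝ}
    (hm : Measurable fun p : ℝ × E3 => ρ p.1 p.2) (hm' : Measurable fun p : ℝ × E3 => ρ' p.1 p.2)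
    (hi : ∀ t ∈ Icc 0 T, Integrable (ρ t)) (hi' : ∀ t ∈ Icc 0 T, Integrable (ρ' t))
    (hM : ∀ t ∈ Icc 0 T, ∀ᵐ x, |ρ t x| ≤ M) (hM' : ∀ t ∈ Icc 0 T, ∀ᵐ x, |ρ' t x| ≤ M)
    (hs : IsTransportSol T v ρ₀ ρ) (hs' : IsTransportSol T v ρ₀ ρ') (n : ℕ) {z : ℝ → E3}
    (hz : ContDiff ℝ (⊤ : ℕ∞) z) {t : ℝ} (ht : t ∈ Icc 0 T) :
    ∫ y, (ρ t y - ρ' t y) * bmp n (z t - y) =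
      ∫ τ in (0:ℝ)..t, ∫ y, (ρ τ y - ρ' τ y) *
        fderiv ℝ (bmp n) (z τ - y) (deriv z τ - v τ y) := by
  have hsl : ∀ t, Measurable (ρ t) := fun t => hm.comp measurable_prodMk_left
  have hsl' : ∀ t, Measurable (ρ' t) := fun t => hm'.comp measurable_prodMk_left
  have hbi : ∀ {g : E3 → ℝ}, Integrable g → Integrable fun y => g y * bmp n (z t - y) :=
    fun {g} hg => by
    have hc : Continuous fun y => bmp n (z t - y) := (bmp n).continuous.comp (by fun_prop)
    refine hg.mul_bdd (c := 1) hc.aestronglyMeasurable (Eventually.of_forall fun y => ?_)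
    rw [Real.norm_eq_abs, abs_of_nonneg (bmp n).nonneg]
    exact (bmp n).le_one
  have e1 : ∫ y, (ρ t y - ρ' t y) * bmp n (z t - y) =
      (∫ y, ρ t y * bmp n (z t - y)) - ∫ y, ρ' t y * bmp n (z t - y) := by
    rw [← integral_sub (hbi (hi t ht)) (hbi (hi' t ht))]
    simp only [sub_mul]
  rw [e1, test_id hT hs (bmp n) hz ht, test_id hT hs' (bmp n) hz ht, add_sub_add_left_eq_sub,
    ← intervalIntegral.integral_sub (h.k_ii n hm hM hz ht) (h.k_ii n hm' hM' hz ht)]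
  refine intervalIntegral.integral_congr fun τ hτ => ?_
  rw [uIcc_of_le ht.1] at hτ
  have hτ' : τ ∈ Icc 0 T := ⟨hτ.1, hτ.2.trans ht.2⟩
  rw [← integral_sub (h.k_int n τ (hsl τ) (hM τ hτ') _ _) (h.k_int n τ (hsl' τ) (hM' τ hτ') _ _)]
  simp only [sub_mul]

lemma halving (h : GoodV Q v) {T : ℝ} {σ : ℝ → E3 → ℝ}
    (hi : ∀ t ∈ Icc 0 T, Integrable (σ t))
    (hid : ∀ (n : ℕ) (z : ℝ → E3), ContDiff ℝ (⊤ : ℕ∞) z → ∀ t ∈ Icc 0 T,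
      ∫ y, σ t y * bmp n (z t - y) = ∫ τ in (0:ℝ)..t, ∫ y, σ τ y *
        fderiv ℝ (bmp n) (z τ - y) (deriv z τ - v τ y)) {m : ℝ}
    (hm : ∀ t ∈ Icc 0 T, ∀ᵐ x, |σ t x| ≤ m * exp ((2 * (Q * bK) + 1) * t)) :
    ∀ t ∈ Icc 0 T, ∀ᵐ x, |σ t x| ≤ m / 2 * exp ((2 * (Q * bK) + 1) * t) := by
  intro t ht
  have hQ := h.Q0
  have hK := bK_nonneg
  have hQK : 0 ≤ Q * bK := mul_nonneg hQ hK
  set l := 2 * (Q * bK) + 1 with hl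
  have hl0 : 0 < l := by positivity
  have hm0 : 0 ≤ m := by
    obtain ⟨x, hx⟩ := (hm t ht).exists
    exact nonneg_of_mul_nonneg_left ((abs_nonneg _).trans hx) (exp_pos _)
  have key : ∀ (n : ℕ) (x : E3), |∫ y, σ t y * bmp n (x - y)| ≤
      m / 2 * exp (l * t) * ∫ y, bmp n y := by
    intro n x
    set B := ∫ y, bmp n y with hB
    have hB0 : 0 < B := bmp_ip n
    set L := ∫ y, ‖fderiv ℝ (bmp n) y‖ with hL
    have hL0 : 0 ≤ L := integral_nonneg fun _ => norm_nonneg _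
    refine le_of_forall_pos_le_add fun ε hε => ?_
    set C := m * exp (l * t) * L with hC
    have hC0 : 0 ≤ C := by positivity
    obtain ⟨z, hz, hzt, hzδ⟩ := h.approx ht x (δ := ε / (C + 1)) (by positivity)
    have hdc : Continuous (deriv z) := hz.continuous_deriv (by simp)
    have hb : ∀ᵐ τ, τ ∈ Ioc 0 t → ‖∫ y, σ τ y *
        fderiv ℝ (bmp n) (z τ - y) (deriv z τ - v τ y)‖ ≤
        C * ‖deriv z τ - v τ (z τ)‖ + m * (Q * (bK * B)) * exp (l * τ) := by
      refine Eventually.of_forall fun τ hτ => ?_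
      refine (h.k_norm n τ (hm τ ⟨hτ.1.le, hτ.2.trans ht.2⟩) (z τ) (deriv z τ)).trans ?_
      have h1 : exp (l * τ) ≤ exp (l * t) := exp_le_exp.2 (mul_le_mul_of_nonneg_left hτ.2 hl0.le)
      calc m * exp (l * τ) * (‖deriv z τ - v τ (z τ)‖ * L + Q * (bK * B))
          = m * exp (l * τ) * L * ‖deriv z τ - v τ (z τ)‖ + m * (Q * (bK * B)) * exp (l * τ) := by
            ring
        _ ≤ _ := by rw [hC]; gcongr
    have hi1 : IntervalIntegrable (fun τ => C * ‖deriv z τ - v τ (z τ)‖) volume 0 t :=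
      (((hdc.intervalIntegrable _ _).sub (h.ii hz.continuous.measurable 0 t)).norm).const_mul C
    have hi2 : IntervalIntegrable (fun τ => m * (Q * (bK * B)) * exp (l * τ)) volume 0 t :=
      Continuous.intervalIntegrable (by fun_prop) _ _
    have h1 := intervalIntegral.norm_integral_le_of_norm_le ht.1 hb (hi1.add hi2)
    rw [← hid n z hz t ht, hzt, intervalIntegral.integral_add hi1 hi2,
      intervalIntegral.integral_const_mul, intervalIntegral.integral_const_mul] at h1
    refine h1.trans ?_
    have h2 : ∫ τ in (0:ℝ)..t, exp (l * τ) ≤ exp (l * t) / l := by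
      rw [intervalIntegral.integral_comp_mul_left (fun x => exp x) hl0.ne', integral_exp]
      simp only [mul_zero, exp_zero, smul_eq_mul]
      rw [inv_mul_eq_div]
      gcongr
      linarith
    have h3 : C * ∫ τ in (0:ℝ)..t, ‖deriv z τ - v τ (z τ)‖ ≤ ε := by
      calc _ ≤ C * (ε / (C + 1)) := by gcongr
        _ ≤ ε := by
          rw [mul_div_assoc', div_le_iff₀ (by positivity)]
          nlinarith
    have h4 : m * (Q * (bK * B)) * ∫ τ in (0:ℝ)..t, exp (l * τ) ≤ m / 2 * exp (l * t) * B := by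
      calc _ ≤ m * (Q * (bK * B)) * (exp (l * t) / l) := by gcongr
        _ = m * exp (l * t) * B * (Q * bK / l) := by ring
        _ ≤ m * exp (l * t) * B * (1 / 2) := by
          refine mul_le_mul_of_nonneg_left ?_ (by positivity)
          rw [div_le_div_iff₀ hl0 two_pos]
          linarith
        _ = _ := by ring
    linarith
  filter_upwards [bmp_tendsto (hi t ht).locallyIntegrable] with x hx
  refine le_of_tendsto hx.abs (Eventually.of_forall fun n => ?_)
  rw [abs_div, abs_of_pos (bmp_ip n), div_le_iff₀ (bmp_ip n)]
  exact key n x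

lemma uniq (h : GoodV Q v) {T : ℝ} (hT : 0 < T) {ρ ρ' : ℝ → E3 → ℝ} {ρ₀ : E3 → ℝ}
    (hρ : InL1Linfty T ρ) (hρ' : InL1Linfty T ρ')
    (hs : IsTransportSol T v ρ₀ ρ) (hs' : IsTransportSol T v ρ₀ ρ') :
    ∀ t ∈ Icc 0 T, ρ t =ᵐ[volume] ρ' t := by
  obtain ⟨r, hr, hrρ⟩ := jm hT hs hρ
  obtain ⟨r', hr', hrρ'⟩ := jm hT hs' hρ'
  have hsr := sol_congr hs (Eventually.of_forall fun _ => rfl) EventuallyEq.rfl hrρ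
  have hsr' := sol_congr hs' (Eventually.of_forall fun _ => rfl) EventuallyEq.rfl hrρ'
  obtain ⟨M₁, hM₁⟩ := hρ
  obtain ⟨M₂, hM₂⟩ := hρ'
  set M := max M₁ M₂
  have hi : ∀ t ∈ Icc 0 T, Integrable (r t) := fun t ht => (hM₁ t ht).1.congr (hrρ t ht)
  have hi' : ∀ t ∈ Icc 0 T, Integrable (r' t) := fun t ht => (hM₂ t ht).1.congr (hrρ' t ht)
  have hb : ∀ t ∈ Icc 0 T, ∀ᵐ x, |r t x| ≤ M := fun t ht => by
    filter_upwards [(hM₁ t ht).2, hrρ t ht] with x h1 h2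
    rw [← h2]; exact h1.trans (le_max_left _ _)
  have hb' : ∀ t ∈ Icc 0 T, ∀ᵐ x, |r' t x| ≤ M := fun t ht => by
    filter_upwards [(hM₂ t ht).2, hrρ' t ht] with x h1 h2
    rw [← h2]; exact h1.trans (le_max_right _ _)
  have hQ := h.Q0
  have hK := bK_nonneg
  have hl0 : 0 ≤ 2 * (Q * bK) + 1 := by positivity
  have key : ∀ k : ℕ, ∀ t ∈ Icc 0 T, ∀ᵐ x,
      |r t x - r' t x| ≤ 2 * M / 2 ^ k * exp ((2 * (Q * bK) + 1) * t) := by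
    intro k
    induction k with
    | zero =>
      intro t ht
      filter_upwards [hb t ht, hb' t ht] with x h1 h2
      have h3 : 1 ≤ exp ((2 * (Q * bK) + 1) * t) := one_le_exp (mul_nonneg hl0 ht.1)
      have h4 : 0 ≤ M := (abs_nonneg _).trans h1
      have h5 := abs_sub (r t x) (r' t x)
      rw [pow_zero, div_one]
      nlinarith
    | succ k ih =>
      have := h.halving (σ := fun t x => r t x - r' t x)
        (fun t ht => (hi t ht).sub (hi' t ht))
        (fun n z hz t ht => h.diff_id hT hr hr' hi hi' hb hb' hsr hsr' n hz ht) ih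
      intro t ht
      filter_upwards [this t ht] with x hx
      refine hx.trans_eq ?_
      rw [pow_succ]
      ring
  intro t ht
  have hall : ∀ᵐ x, ∀ k : ℕ,
      |r t x - r' t x| ≤ 2 * M / 2 ^ k * exp ((2 * (Q * bK) + 1) * t) :=
    ae_all_iff.2 fun k => key k t ht
  filter_upwards [hall, hrρ t ht, hrρ' t ht] with x hx h1 h2
  rw [h1, h2]
  have hlim : Tendsto (fun k : ℕ => 2 * M / 2 ^ k * exp ((2 * (Q * bK) + 1) * t)) atTop (𝓝 0) := by
    have h3 := tendsto_pow_atTop_nhds_zero_of_lt_one (r := (1/2 : ℝ)) (by norm_num) (by norm_num)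
    have h4 := h3.const_mul (2 * M * exp ((2 * (Q * bK) + 1) * t))
    rw [mul_zero] at h4
    refine h4.congr fun k => ?_
    rw [one_div, inv_pow]
    ring
  have h5 := ge_of_tendsto' hlim hx
  exact sub_eq_zero.1 (abs_nonpos_iff.1 h5)

end GoodV
lemma densM_congr {η η' : E3 → ℝ} (h : η =ᵐ[volume] η') : densM η = densM η' :=
  withDensity_congr_ae (by filter_upwards [h] with x hx; rw [hx])

lemma W1_lt_top {μ ν : Measure E3} [IsFiniteMeasure μ] [IsFiniteMeasure ν] (hm : μ univ = ν univ)
    (hμ : ∫⁻ x, ‖x‖ₑ ∂μ < ⊤) (hν : ∫⁻ x, ‖x‖ₑ ∂ν < ⊤) : W1 μ ν < ⊤ := by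
  by_cases h0 : μ univ = 0
  · have e1 : μ = 0 := Measure.measure_univ_eq_zero.1 h0
    have e2 : ν = 0 := Measure.measure_univ_eq_zero.1 (hm ▸ h0)
    have : W1 μ ν ≤ ∫⁻ p : E3 × E3, ‖p.1 - p.2‖₊ ∂(0 : Measure (E3 × E3)) :=
      iInf₂_le (0 : Measure (E3 × E3)) ⟨by simp [e1], by simp [e2]⟩
    refine this.trans_lt ?_
    simp
  · have hfin : μ univ ≠ ⊤ := measure_ne_top _ _
    have : W1 μ ν ≤ ∫⁻ p : E3 × E3, ‖p.1 - p.2‖₊ ∂((μ univ)⁻¹ • μ.prod ν) := by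
      refine iInf₂_le ((μ univ)⁻¹ • μ.prod ν) ⟨?_, ?_⟩
      · rw [Measure.map_smul, Measure.map_fst_prod, ← hm, smul_smul,
          ENNReal.inv_mul_cancel h0 hfin, one_smul]
      · rw [Measure.map_smul, Measure.map_snd_prod, smul_smul,
          ENNReal.inv_mul_cancel h0 hfin, one_smul]
    refine this.trans_lt ?_
    rw [lintegral_smul_measure, smul_eq_mul]
    refine ENNReal.mul_lt_top (ENNReal.inv_lt_top.2 (pos_iff_ne_zero.2 h0)) ?_
    calc ∫⁻ p : E3 × E3, ‖p.1 - p.2‖₊ ∂(μ.prod ν)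
        ≤ ∫⁻ p : E3 × E3, (‖p.1‖ₑ + ‖p.2‖ₑ) ∂(μ.prod ν) :=
          lintegral_mono fun p => enorm_sub_le
      _ = (∫⁻ p : E3 × E3, ‖p.1‖ₑ ∂(μ.prod ν)) + ∫⁻ p : E3 × E3, ‖p.2‖ₑ ∂(μ.prod ν) :=
          lintegral_add_left (by fun_prop) _
      _ = ν univ * (∫⁻ x, ‖x‖ₑ ∂μ) + μ univ * ∫⁻ x, ‖x‖ₑ ∂ν := by
          rw [← lintegral_map (f := fun x : E3 => ‖x‖ₑ) (by fun_prop) measurable_fst,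
            ← lintegral_map (f := fun x : E3 => ‖x‖ₑ) (by fun_prop) measurable_snd,
            Measure.map_fst_prod, Measure.map_snd_prod, lintegral_smul_measure,
            lintegral_smul_measure, smul_eq_mul, smul_eq_mul]
      _ < ⊤ := ENNReal.add_lt_top.2 ⟨ENNReal.mul_lt_top (measure_lt_top _ _) hμ,
          ENNReal.mul_lt_top (measure_lt_top _ _) hν⟩

lemma dens_lint {η : E3 → ℝ} (hη : AEMeasurable η) (h0 : ∀ x, 0 ≤ η x) {f : E3 → ℝ}
    (hf : Measurable f) (hf0 : ∀ x, 0 ≤ f x) (hi : Integrable fun x => f x * η x) :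
    ∫⁻ x, ENNReal.ofReal (f x) ∂(densM η) = ENNReal.ofReal (∫ x, f x * η x) := by
  rw [densM, lintegral_withDensity_eq_lintegral_mul₀ hη.ennreal_ofReal
    hf.ennreal_ofReal.aemeasurable, ofReal_integral_eq_lintegral_ofReal hi
    (Eventually.of_forall fun x => mul_nonneg (hf0 x) (h0 x))]
  refine lintegral_congr fun x => ?_
  rw [Pi.mul_apply, ENNReal.ofReal_mul (hf0 x), mul_comm]

lemma dens_univ {η : E3 → ℝ} (h0 : ∀ x, 0 ≤ η x) (hi : Integrable η) :
    densM η univ = ENNReal.ofReal (∫ x, η x) := by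
  have := dens_lint hi.aemeasurable h0 (f := fun _ => 1) measurable_const (fun _ => zero_le_one)
    (by simpa using hi)
  simpa using this

lemma two_flow {Q₁ Q₂ : ℝ} {v₁ v₂ : ℝ → E3 → E3} (h₁ : GoodV Q₁ v₁) (h₂ : GoodV Q₂ v₂) {s t : ℝ}
    (hst : s ≤ t) (x y : E3) : ‖h₁.flow s t x - h₂.flow s t y‖ ≤
      (‖x - y‖ + ∫ τ in s..t, ‖v₂ τ (h₁.flow s τ x) - v₁ τ (h₁.flow s τ x)‖) *
        exp (Q₂ * (t - s)) := by
  have hX := h₁.flow_traj s x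
  have hY := h₂.flow_traj s y
  have hXm := hX.1.measurable
  have hYm := hY.1.measurable
  set X := fun τ => h₁.flow s τ x with hXd
  set Y := fun τ => h₂.flow s τ y with hYd
  have hXs : X s = x := h₁.flow_self s x
  have hYs : Y s = y := h₂.flow_self s y
  have hdi : ∀ a b, IntervalIntegrable (fun τ => ‖v₂ τ (X τ) - v₁ τ (X τ)‖) volume a b :=
    fun a b => ((h₂.ii hXm a b).sub (h₁.ii hXm a b)).norm
  refine gron (f := fun τ => ‖X τ - Y τ‖) (hX.1.sub hY.1).norm h₂.Q0 hst fun r hr => ?_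
  have e1 : X r - Y r = (x - y) + ∫ τ in s..r, (v₁ τ (X τ) - v₂ τ (Y τ)) := by
    rw [intervalIntegral.integral_sub (h₁.ii hXm s r) (h₂.ii hYm s r), ← hX.2 s r, ← hY.2 s r,
      hXs, hYs]
    abel
  have hc : Continuous fun τ => Q₂ * ‖X τ - Y τ‖ := continuous_const.mul (hX.1.sub hY.1).norm
  have e2 : ‖∫ τ in s..r, (v₁ τ (X τ) - v₂ τ (Y τ))‖ ≤
      ∫ τ in s..r, (‖v₂ τ (X τ) - v₁ τ (X τ)‖ + Q₂ * ‖X τ - Y τ‖) := by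
    refine intervalIntegral.norm_integral_le_of_norm_le hr.1 (Eventually.of_forall fun τ _ => ?_)
      ((hdi s r).add (hc.intervalIntegrable _ _))
    have : v₁ τ (X τ) - v₂ τ (Y τ) = -(v₂ τ (X τ) - v₁ τ (X τ)) + (v₂ τ (X τ) - v₂ τ (Y τ)) := by
      abel
    rw [this]
    refine (norm_add_le _ _).trans ?_
    rw [norm_neg]
    gcongr
    exact h₂.lip _ _ _
  rw [intervalIntegral.integral_add (hdi s r) (hc.intervalIntegrable _ _),
    intervalIntegral.integral_const_mul] at e2
  have e3 : ∫ τ in s..r, ‖v₂ τ (X τ) - v₁ τ (X τ)‖ ≤ ∫ τ in s..t, ‖v₂ τ (X τ) - v₁ τ (X τ)‖ := by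
    refine intervalIntegral.integral_mono_interval le_rfl hr.1 hr.2
      (Eventually.of_forall fun _ => norm_nonneg _) (hdi s t)
  rw [e1]
  refine (norm_add_le _ _).trans ?_
  linarith

lemma W1_le {μ ν : Measure E3} (γ : Measure (E3 × E3)) (h1 : γ.map Prod.fst = μ)
    (h2 : γ.map Prod.snd = ν) : W1 μ ν ≤ ∫⁻ p, ‖p.1 - p.2‖₊ ∂γ :=
  iInf₂_le γ ⟨h1, h2⟩

lemma le_W1 {μ ν : Measure E3} {a : ENNReal} (h : ∀ γ : Measure (E3 × E3), γ.map Prod.fst = μ →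
    γ.map Prod.snd = ν → a ≤ ∫⁻ p, ‖p.1 - p.2‖₊ ∂γ) : a ≤ W1 μ ν :=
  le_iInf₂ fun γ hγ => h γ hγ.1 hγ.2

lemma W1_step {Q₁ Q₂ : ℝ} {v₁ v₂ : ℝ → E3 → E3} (h₁ : GoodV Q₁ v₁) (h₂ : GoodV Q₂ v₂) {s t : ℝ}
    (hst : s ≤ t) (μ ν : Measure E3) [SFinite μ] :
    W1 (μ.map (h₁.flow s t)) (ν.map (h₂.flow s t)) ≤
      (W1 μ ν + ∫⁻ τ in Ioc s t, ∫⁻ y, ENNReal.ofReal ‖v₂ τ y - v₁ τ y‖ ∂(μ.map (h₁.flow s τ))) *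
        ENNReal.ofReal (exp (Q₂ * (t - s))) := by
  set E := ENNReal.ofReal (exp (Q₂ * (t - s))) with hE
  have hE0 : E ≠ 0 := (ENNReal.ofReal_pos.2 (exp_pos _)).ne'
  have hEt : E ≠ ⊤ := ENNReal.ofReal_ne_top
  set I := ∫⁻ τ in Ioc s t, ∫⁻ y, ENNReal.ofReal ‖v₂ τ y - v₁ τ y‖ ∂(μ.map (h₁.flow s τ)) with hI
  have hd2 : Measurable fun p : ℝ × E3 => v₂ p.1 p.2 - v₁ p.1 p.2 := h₂.measU.sub h₁.measU
  have hdm : Measurable fun p : ℝ × E3 => ENNReal.ofReal ‖v₂ p.1 p.2 - v₁ p.1 p.2‖ :=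
    hd2.norm.ennreal_ofReal
  have hfm : Measurable fun p : E3 × ℝ => h₁.flow s p.2 p.1 := (h₁.flow_meas s).comp measurable_swap
  have hdm' : Measurable fun p : E3 × ℝ =>
      ENNReal.ofReal ‖v₂ p.2 (h₁.flow s p.2 p.1) - v₁ p.2 (h₁.flow s p.2 p.1)‖ :=
    ((h₂.measU.comp (measurable_snd.prodMk hfm)).sub
      (h₁.measU.comp (measurable_snd.prodMk hfm))).norm.ennreal_ofReal
  have key : ∀ γ : Measure (E3 × E3), γ.map Prod.fst = μ → γ.map Prod.snd = ν →
      W1 (μ.map (h₁.flow s t)) (ν.map (h₂.flow s t)) ≤ ((∫⁻ p, ‖p.1 - p.2‖₊ ∂γ) + I) * E := by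
    intro γ hγ1 hγ2
    have hm1 := (h₁.flow_cont s t).measurable
    have hm2 := (h₂.flow_cont s t).measurable
    have hmm : Measurable (Prod.map (h₁.flow s t) (h₂.flow s t)) := hm1.prodMap hm2
    have hle : W1 (μ.map (h₁.flow s t)) (ν.map (h₂.flow s t)) ≤
        ∫⁻ p : E3 × E3, ‖p.1 - p.2‖₊ ∂(γ.map (Prod.map (h₁.flow s t) (h₂.flow s t))) := by
      refine W1_le _ ?_ ?_
      · rw [Measure.map_map measurable_fst hmm, ← hγ1, Measure.map_map hm1 measurable_fst]
        rfl
      · rw [Measure.map_map measurable_snd hmm, ← hγ2, Measure.map_map hm2 measurable_snd]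
        rfl
    refine hle.trans ?_
    rw [lintegral_map (by fun_prop) hmm]
    have hpt : ∀ p : E3 × E3, (‖h₁.flow s t p.1 - h₂.flow s t p.2‖₊ : ENNReal) ≤
        (‖p.1 - p.2‖₊ + ∫⁻ τ in Ioc s t, ENNReal.ofReal
          ‖v₂ τ (h₁.flow s τ p.1) - v₁ τ (h₁.flow s τ p.1)‖) * E := by
      intro p
      have hXm := (h₁.flow_traj s p.1).1.measurable
      have hdi : IntegrableOn (fun τ => ‖v₂ τ (h₁.flow s τ p.1) - v₁ τ (h₁.flow s τ p.1)‖)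
          (Ioc s t) := (((h₂.ii hXm s t).sub (h₁.ii hXm s t)).norm).1
      have h3 := ENNReal.ofReal_le_ofReal (two_flow h₁ h₂ hst p.1 p.2)
      rw [ENNReal.ofReal_mul (add_nonneg (norm_nonneg _)
        (intervalIntegral.integral_nonneg hst fun _ _ => norm_nonneg _)),
        ENNReal.ofReal_add (norm_nonneg _)
        (intervalIntegral.integral_nonneg hst fun _ _ => norm_nonneg _),
        intervalIntegral.integral_of_le hst, ofReal_integral_eq_lintegral_ofReal hdi
          (Eventually.of_forall fun _ => norm_nonneg _), ofReal_norm, ofReal_norm] at h3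
      exact h3
    refine (lintegral_mono hpt).trans_eq ?_
    rw [lintegral_mul_const' _ _ hEt, lintegral_add_left (by fun_prop)]
    congr 2
    have hin : Measurable fun x : E3 => ∫⁻ τ in Ioc s t, ENNReal.ofReal
        ‖v₂ τ (h₁.flow s τ x) - v₁ τ (h₁.flow s τ x)‖ := hdm'.lintegral_prod_right'
    rw [← lintegral_map (μ := γ) (g := Prod.fst) hin measurable_fst, hγ1,
      lintegral_lintegral_swap hdm'.aemeasurable, hI]
    refine lintegral_congr fun τ => ?_
    have hsl : Measurable fun y => ENNReal.ofReal ‖v₂ τ y - v₁ τ y‖ :=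
      ((h₂.cont τ).sub (h₁.cont τ)).norm.measurable.ennreal_ofReal
    rw [lintegral_map hsl (h₁.flow_cont s τ).measurable]
  have h4 : W1 (μ.map (h₁.flow s t)) (ν.map (h₂.flow s t)) / E - I ≤ W1 μ ν := by
    refine le_W1 fun γ hγ1 hγ2 => ?_
    rw [tsub_le_iff_right]
    exact ENNReal.div_le_of_le_mul (key γ hγ1 hγ2)
  rw [tsub_le_iff_right] at h4
  exact (ENNReal.div_le_iff hE0 hEt).1 h4

lemma GoodV.densM_flow {Q : ℝ} {v : ℝ → E3 → E3} (h : GoodV Q v) {T : ℝ} (hT : 0 < T)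
    {ρ₀ : E3 → ℝ} {ρ : ℝ → E3 → ℝ} (hρ : InL1Linfty T ρ) (hs : IsTransportSol T v ρ₀ ρ) {s t : ℝ}
    (hs' : s ∈ Icc 0 T) (ht : t ∈ Icc 0 T) : densM (ρ t) = (densM (ρ s)).map (h.flow s t) := by
  obtain ⟨M, hM⟩ := id hρ
  have h0 : (0:ℝ) ∈ Icc 0 T := ⟨le_rfl, hT.le⟩
  obtain ⟨g, hgm, hg⟩ := (hM 0 h0).1.aemeasurable
  have hgi : Integrable g := (hM 0 h0).1.congr hg
  have hgb : ∀ᵐ x, |g x| ≤ M := by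
    filter_upwards [(hM 0 h0).2, hg] with x h1 h2
    rwa [← h2]
  have hsg : IsTransportSol T v g ρ := sol_congr (sol_zero hT hs)
    (Eventually.of_forall fun _ => rfl) hg fun _ _ => EventuallyEq.rfl
  have hpf : InL1Linfty T (h.pf g) := ⟨exp (Q * T) ^ 3 * M, fun t ht =>
    ⟨h.pf_integrable hgi t, h.pf_bdd hgb ht⟩⟩
  have hu := h.uniq hT hρ hpf hsg (h.pf_sol hgi T)
  rw [densM_congr (hu t ht), densM_congr (hu s hs'), h.pf_densM hgm, h.pf_densM hgm,
    Measure.map_map (h.flow_cont s t).measurable (h.flow_cont 0 s).measurable]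
  congr 1
  ext1 x
  exact (h.flow_comp 0 s t x).symm

theorem transport_wellposedness_and_wasserstein_stability (T : ℝ) (hT : 0 < T) :
    -- existence and uniqueness in L∞(0,T; L¹ ∩ L∞)
    (∀ (u : ℝ → EuclideanSpace ℝ (Fin 3) → EuclideanSpace ℝ (Fin 3)) (Q : ℝ),
      InW1inftyBdd T Q u →
      ∀ ρ₀ : EuclideanSpace ℝ (Fin 3) → ℝ, Integrable ρ₀ → (∃ M₀, ∀ᵐ x, |ρ₀ x| ≤ M₀) →
        ∃ ρ, InL1Linfty T ρ ∧ IsTransportSol T u ρ₀ ρ ∧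
          ∀ ρ', InL1Linfty T ρ' → IsTransportSol T u ρ₀ ρ' →
            ∀ t ∈ Set.Icc 0 T, ρ' t =ᵐ[volume] ρ t) ∧
    -- Wasserstein stability estimate
    (∀ (u₁ u₂ : ℝ → EuclideanSpace ℝ (Fin 3) → EuclideanSpace ℝ (Fin 3)) (Q₁ Q₂ : ℝ)
      (ρ₀₁ ρ₀₂ : EuclideanSpace ℝ (Fin 3) → ℝ) (ρ₁ ρ₂ : ℝ → EuclideanSpace ℝ (Fin 3) → ℝ),
      InW1inftyBdd T Q₁ u₁ → InW1inftyBdd T Q₂ u₂ →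
      InL1Linfty T ρ₁ → InL1Linfty T ρ₂ →
      IsTransportSol T u₁ ρ₀₁ ρ₁ → IsTransportSol T u₂ ρ₀₂ ρ₂ →
      (∀ t ∈ Set.Icc 0 T, ∀ x, 0 ≤ ρ₁ t x) → (∀ t ∈ Set.Icc 0 T, ∀ x, 0 ≤ ρ₂ t x) →
      (∀ t ∈ Set.Icc 0 T, (∫ x, ρ₁ t x) = ∫ x, ρ₂ t x) →
      (∀ t ∈ Set.Icc 0 T, Integrable (fun x => ‖x‖ * ρ₁ t x)) →
      (∀ t ∈ Set.Icc 0 T, Integrable (fun x => ‖x‖ * ρ₂ t x)) →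
      IntervalIntegrable (fun τ => ∫ x, ‖u₂ τ x - u₁ τ x‖ * ρ₁ τ x) volume 0 T →
      ∀ s t, 0 ≤ s → s ≤ t → t ≤ T →
        (W1 (densM (ρ₁ t)) (densM (ρ₂ t))).toReal ≤
          ((W1 (densM (ρ₁ s)) (densM (ρ₂ s))).toReal +
            ∫ τ in s..t, ∫ x, ‖u₂ τ x - u₁ τ x‖ * ρ₁ τ x) * Real.exp (Q₂ * (t - s))) := by
  constructor
  · intro u Q hu ρ₀ hρi hρb
    obtain ⟨v, hv, hvu⟩ := exists_good hT hu
    obtain ⟨M₀, hM₀⟩ := hρb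
    have hvu' : ∀ᵐ t ∂(volume.restrict (Icc 0 T)), u t = v t := hvu.mono fun t ht => ht.symm
    have hpf : InL1Linfty T (hv.pf ρ₀) := ⟨exp (Q * T) ^ 3 * M₀, fun t ht =>
      ⟨hv.pf_integrable hρi t, hv.pf_bdd hM₀ ht⟩⟩
    refine ⟨hv.pf ρ₀, hpf, sol_congr (hv.pf_sol hρi T) hvu EventuallyEq.rfl
      fun _ _ => EventuallyEq.rfl, fun ρ' hρ' hs' => ?_⟩
    exact hv.uniq hT hρ' hpf (sol_congr hs' hvu' EventuallyEq.rfl fun _ _ => EventuallyEq.rfl)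
      (hv.pf_sol hρi T)
  · intro u₁ u₂ Q₁ Q₂ ρ₀₁ ρ₀₂ ρ₁ ρ₂ hu₁ hu₂ hρ₁ hρ₂ hs₁ hs₂ hp₁ hp₂ hmass hf₁ hf₂ hii s t hs hst ht
    obtain ⟨v₁, hv₁, hvu₁⟩ := exists_good hT hu₁
    obtain ⟨v₂, hv₂, hvu₂⟩ := exists_good hT hu₂
    have hsv₁ := sol_congr hs₁ (hvu₁.mono fun t ht => ht.symm) EventuallyEq.rfl
      fun _ _ => EventuallyEq.rfl
    have hsv₂ := sol_congr hs₂ (hvu₂.mono fun t ht => ht.symm) EventuallyEq.rfl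
      fun _ _ => EventuallyEq.rfl
    have hsm : s ∈ Icc 0 T := ⟨hs, hst.trans ht⟩
    have htm : t ∈ Icc 0 T := ⟨hs.trans hst, ht⟩
    obtain ⟨M₁, hM₁⟩ := id hρ₁
    obtain ⟨M₂, hM₂⟩ := id hρ₂
    have hun₁ := dens_univ (hp₁ s hsm) (hM₁ s hsm).1
    have hun₂ := dens_univ (hp₂ s hsm) (hM₂ s hsm).1
    have : IsFiniteMeasure (densM (ρ₁ s)) := ⟨by rw [hun₁]; exact ENNReal.ofReal_lt_top⟩
    have : IsFiniteMeasure (densM (ρ₂ s)) := ⟨by rw [hun₂]; exact ENNReal.ofReal_lt_top⟩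
    have hW : W1 (densM (ρ₁ s)) (densM (ρ₂ s)) < ⊤ := by
      refine W1_lt_top (by rw [hun₁, hun₂, hmass s hsm]) ?_ ?_
      · have := dens_lint (hM₁ s hsm).1.aemeasurable (hp₁ s hsm) measurable_norm
          (fun x => norm_nonneg x) (hf₁ s hsm)
        simp only [ofReal_norm] at this
        rw [this]
        exact ENNReal.ofReal_lt_top
      · have := dens_lint (hM₂ s hsm).1.aemeasurable (hp₂ s hsm) measurable_norm
          (fun x => norm_nonneg x) (hf₂ s hsm)
        simp only [ofReal_norm] at this
        rw [this]
        exact ENNReal.ofReal_lt_top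
    have hstep := W1_step hv₁ hv₂ hst (densM (ρ₁ s)) (densM (ρ₂ s))
    rw [← hv₁.densM_flow hT hρ₁ hsv₁ hsm htm, ← hv₂.densM_flow hT hρ₂ hsv₂ hsm htm] at hstep
    have hG0 : ∀ τ ∈ Ioc s t, 0 ≤ ∫ x, ‖u₂ τ x - u₁ τ x‖ * ρ₁ τ x := fun τ hτ =>
      integral_nonneg fun x => mul_nonneg (norm_nonneg _)
        (hp₁ τ ⟨hs.trans hτ.1.le, hτ.2.trans ht⟩ x)
    have hGi : IntegrableOn (fun τ => ∫ x, ‖u₂ τ x - u₁ τ x‖ * ρ₁ τ x) (Ioc s t) :=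
      hii.1.mono_set (Ioc_subset_Ioc hs ht)
    have hI : (∫⁻ τ in Ioc s t, ∫⁻ y, ENNReal.ofReal ‖v₂ τ y - v₁ τ y‖
        ∂((densM (ρ₁ s)).map (hv₁.flow s τ))) =
        ENNReal.ofReal (∫ τ in s..t, ∫ x, ‖u₂ τ x - u₁ τ x‖ * ρ₁ τ x) := by
      rw [intervalIntegral.integral_of_le hst, ofReal_integral_eq_lintegral_ofReal hGi
        ((ae_restrict_mem measurableSet_Ioc).mono hG0)]
      refine setLIntegral_congr_fun_ae measurableSet_Ioc ?_
      rw [ae_restrict_iff' measurableSet_Icc] at hvu₁ hvu₂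
      filter_upwards [hvu₁, hvu₂] with τ e1 e2 hτ
      have hτ' : τ ∈ Icc 0 T := ⟨hs.trans hτ.1.le, hτ.2.trans ht⟩
      rw [← hv₁.densM_flow hT hρ₁ hsv₁ hsm hτ', ← e1 hτ', ← e2 hτ']
      have hdm : Measurable fun y => ‖v₂ τ y - v₁ τ y‖ :=
        ((hv₂.cont τ).sub (hv₁.cont τ)).norm.measurable
      refine dens_lint (hM₁ τ hτ').1.aemeasurable (hp₁ τ hτ') hdm (fun _ => norm_nonneg _) ?_
      refine (hM₁ τ hτ').1.bdd_mul (c := Q₂ + Q₁) hdm.aestronglyMeasurable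
        (Eventually.of_forall fun y => ?_)
      rw [norm_norm]
      exact (norm_sub_le _ _).trans (add_le_add (hv₂.bdd _ _) (hv₁.bdd _ _))
    rw [hI] at hstep
    have hI0 : 0 ≤ ∫ τ in s..t, ∫ x, ‖u₂ τ x - u₁ τ x‖ * ρ₁ τ x := by
      rw [intervalIntegral.integral_of_le hst]
      exact setIntegral_nonneg measurableSet_Ioc hG0
    have hfin := ENNReal.toReal_mono (ENNReal.mul_ne_top (ENNReal.add_ne_top.2
      ⟨hW.ne, ENNReal.ofReal_ne_top⟩) ENNReal.ofReal_ne_top) hstep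
    rwa [ENNReal.toReal_mul, ENNReal.toReal_add hW.ne ENNReal.ofReal_ne_top,
      ENNReal.toReal_ofReal hI0, ENNReal.toReal_ofReal (exp_pos _).le] at hfin
end
end

section
/- Volume conservation identity for the surface operators: Let r : [0,π] → (0,∞) be Lipschitz and let ċ₃ ∈ ℝ be arbitrary in the definition of A₁[r] and A₂[r]. Then ∫₀^π ( A₂[r](θ) − r′(θ) A₁[r](θ) ) r(θ)² sin θ dθ = 0. Consequently, along any solution of ∂_t r + A₁[r] ∂_θ r = A₂[r], one has ∫₀^π ∂_t r(t,θ) r(t,θ)² sin θ dθ = 0, i.e. the droplet volume (2π/3) ∫₀^π r(t,θ)³ sin θ dθ is constant in time. -/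
/- Volume conservation identity for the surface operators: for Lipschitz positive r and any ċ₃,
   ∫₀^π (A₂[r](θ) − r′(θ) A₁[r](θ)) r(θ)² sin θ dθ = 0; consequently along any solution of
   ∂_t r + A₁[r] ∂_θ r = A₂[r], ∫₀^π ∂_t r r² sin θ dθ = 0 and the droplet volume
   (2π/3) ∫₀^π r³ sin θ dθ is constant in time. -/

noncomputable section
open MeasureTheory Real Set Filter

/-- `β[r](θ,θ̄,φ)`. -/
def betaR (r : ℝ → ℝ) (θ θb φ : ℝ) : ℝ :=
  Real.sqrt (r θ ^ 2 + r θb ^ 2 -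
    2 * r θ * r θb * (Real.sin θ * Real.sin θb * Real.cos φ + Real.cos θ * Real.cos θb))

/-- The nonlocal transport coefficient `A₁[r]` (with reference-center velocity `c3dot`). -/
def A1op (r : ℝ → ℝ) (c3dot : ℝ) (θ : ℝ) : ℝ :=
  -(1 / (8 * π * r θ)) *
    (∫ φ in (0:ℝ)..(2 * π), ∫ θb in (0:ℝ)..π,
      (r θb * Real.sin θb - deriv r θb * Real.cos θb) / betaR r θ θb φ *
        (r θb * Real.sin θb) *
        (r θ * Real.cos φ -
          r θb * (Real.cos θb * Real.cos θ * Real.cos φ + Real.sin θb * Real.sin θ)))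
  + c3dot * Real.sin θ / r θ

/-- The nonlocal source term `A₂[r]` (with reference-center velocity `c3dot`). -/
def A2op (r : ℝ → ℝ) (c3dot : ℝ) (θ : ℝ) : ℝ :=
  -(1 / (8 * π)) *
    (∫ φ in (0:ℝ)..(2 * π), ∫ θb in (0:ℝ)..π,
      (r θb * Real.sin θb - deriv r θb * Real.cos θb) / betaR r θ θb φ *
        (r θb * Real.sin θb) *
        (-(r θb) * Real.sin θ * Real.cos θb * Real.cos φ + r θb * Real.cos θ * Real.sin θb))
  - c3dot * Real.cos θ

/-- Measurable and bounded real functions. -/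
def VcBM {α : Type} [MeasurableSpace α] (f : α → ℝ) : Prop :=
  Measurable f ∧ ∃ C : ℝ, ∀ x, |f x| ≤ C

namespace VcBM
variable {α : Type} [MeasurableSpace α] {f g : α → ℝ}

theorem add (hf : VcBM f) (hg : VcBM g) : VcBM (fun x => f x + g x) := by
  obtain ⟨hf, C, hC⟩ := hf
  obtain ⟨hg, D, hD⟩ := hg
  exact ⟨hf.add hg, C + D, fun x => (abs_add_le _ _).trans (add_le_add (hC x) (hD x))⟩

theorem sub (hf : VcBM f) (hg : VcBM g) : VcBM (fun x => f x - g x) := by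
  obtain ⟨hf, C, hC⟩ := hf
  obtain ⟨hg, D, hD⟩ := hg
  exact ⟨hf.sub hg, C + D, fun x => (abs_sub _ _).trans (add_le_add (hC x) (hD x))⟩

theorem mul (hf : VcBM f) (hg : VcBM g) : VcBM (fun x => f x * g x) := by
  obtain ⟨hf, C, hC⟩ := hf
  obtain ⟨hg, D, hD⟩ := hg
  refine ⟨hf.mul hg, C * D, fun x => ?_⟩
  rw [abs_mul]
  exact mul_le_mul (hC x) (hD x) (abs_nonneg _) ((abs_nonneg _).trans (hC x))

theorem comp {β : Type} [MeasurableSpace β] {u : β → α} (hf : VcBM f) (hu : Measurable u) :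
    VcBM (fun x => f (u x)) := by
  obtain ⟨hf, C, hC⟩ := hf
  exact ⟨hf.comp hu, C, fun x => hC _⟩

theorem integrable (hf : VcBM f) (μ : Measure α) [IsFiniteMeasure μ] : Integrable f μ := by
  obtain ⟨hf, C, hC⟩ := hf
  exact Integrable.of_bound hf.aestronglyMeasurable C (Eventually.of_forall hC)

end VcBM

theorem vc_beta_arg (r : ℝ → ℝ) (θ θb φ : ℝ) :
    r θ ^ 2 + r θb ^ 2 -
    2 * r θ * r θb * (Real.sin θ * Real.sin θb * Real.cos φ + Real.cos θ * Real.cos θb)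
    = (r θ * sin θ * cos φ - r θb * sin θb) ^ 2 + (r θ * sin θ * sin φ) ^ 2
      + (r θ * cos θ - r θb * cos θb) ^ 2 := by
  have h1 := sin_sq_add_cos_sq θ
  have h2 := sin_sq_add_cos_sq θb
  have h3 := sin_sq_add_cos_sq φ
  linear_combination (-r θ ^ 2) * h1 - r θb ^ 2 * h2 - r θ ^ 2 * sin θ ^ 2 * h3

theorem vc_beta_sq (r : ℝ → ℝ) (θ θb φ : ℝ) :
    betaR r θ θb φ ^ 2
    = (r θ * sin θ * cos φ - r θb * sin θb) ^ 2 + (r θ * sin θ * sin φ) ^ 2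
      + (r θ * cos θ - r θb * cos θb) ^ 2 := by
  unfold betaR
  rw [vc_beta_arg, Real.sq_sqrt (by positivity)]

theorem vc_beta_nonneg (r : ℝ → ℝ) (θ θb φ : ℝ) : 0 ≤ betaR r θ θb φ := Real.sqrt_nonneg _

theorem vc_b1 (r : ℝ → ℝ) (θ θb φ : ℝ) :
    |r θ * cos θ - r θb * cos θb| ≤ betaR r θ θb φ :=
  abs_le_of_sq_le_sq (by rw [vc_beta_sq]; nlinarith [sq_nonneg (r θ * sin θ * cos φ - r θb * sin θb), sq_nonneg (r θ * sin θ * sin φ)])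
    (vc_beta_nonneg _ _ _ _)

theorem vc_b2 (r : ℝ → ℝ) (θ θb φ : ℝ) :
    |r θ * sin θ * cos φ - r θb * sin θb| ≤ betaR r θ θb φ :=
  abs_le_of_sq_le_sq (by rw [vc_beta_sq]; nlinarith [sq_nonneg (r θ * cos θ - r θb * cos θb), sq_nonneg (r θ * sin θ * sin φ)])
    (vc_beta_nonneg _ _ _ _)

theorem vc_b3 (r : ℝ → ℝ) (θ θb φ : ℝ) :
    |r θ * sin θ * sin φ| ≤ betaR r θ θb φ :=
  abs_le_of_sq_le_sq (by rw [vc_beta_sq]; nlinarith [sq_nonneg (r θ * cos θ - r θb * cos θb), sq_nonneg (r θ * sin θ * cos φ - r θb * sin θb)])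
    (vc_beta_nonneg _ _ _ _)

theorem vc_b4 (r : ℝ → ℝ) (θ θb φ : ℝ) :
    |r θ * sin θ - r θb * sin θb * cos φ| ≤ betaR r θ θb φ := by
  refine abs_le_of_sq_le_sq ?_ (vc_beta_nonneg _ _ _ _)
  have h : betaR r θ θb φ ^ 2 = (r θ * sin θ - r θb * sin θb * cos φ) ^ 2
      + (r θb * sin θb * sin φ) ^ 2 + (r θ * cos θ - r θb * cos θb) ^ 2 := by
    rw [vc_beta_sq]
    linear_combination (r θ ^ 2 * sin θ ^ 2 - r θb ^ 2 * sin θb ^ 2) * sin_sq_add_cos_sq φ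
  rw [h]
  nlinarith [sq_nonneg (r θ * cos θ - r θb * cos θb), sq_nonneg (r θb * sin θb * sin φ)]

theorem vc_b5 (r : ℝ → ℝ) (B : ℝ) (hpos : ∀ θ, 0 < r θ) (hB : ∀ θ, r θ ≤ B) (θ θb φ : ℝ) :
    |betaR r θ θb φ| ≤ 2 * B := by
  rw [abs_of_nonneg (vc_beta_nonneg _ _ _ _)]
  have h0 := hpos θ
  have h1 := hpos θb
  have hc : -1 ≤ Real.sin θ * Real.sin θb * Real.cos φ + Real.cos θ * Real.cos θb := by
    have h1 := sin_sq_add_cos_sq θ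
    have h2 := sin_sq_add_cos_sq θb
    have h3 := sin_sq_add_cos_sq φ
    nlinarith [sq_nonneg (sin θ * cos φ + sin θb), sq_nonneg (cos θ + cos θb),
      sq_nonneg (sin θ * sin φ)]
  calc betaR r θ θb φ ≤ r θ + r θb := by
        unfold betaR
        rw [Real.sqrt_le_left (by positivity)]
        nlinarith [mul_pos h0 h1]
    _ ≤ 2 * B := by linarith [hB θ, hB θb]

theorem vc_beta_pos (r : ℝ → ℝ) (hpos : ∀ θ, 0 < r θ) (θ θb φ : ℝ) (h : θ ∈ Icc 0 π)
    (hb : θb ∈ Icc 0 π) (hne : θ ≠ θb) : 0 < betaR r θ θb φ := by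
  refine lt_of_le_of_ne (vc_beta_nonneg _ _ _ _) fun h0 => hne ?_
  have h1 := vc_b1 r θ θb φ
  have h2 := vc_b2 r θ θb φ
  have h3 := vc_b3 r θ θb φ
  rw [← h0] at h1 h2 h3
  replace h1 := abs_eq_zero.1 (le_antisymm h1 (abs_nonneg _))
  replace h2 := abs_eq_zero.1 (le_antisymm h2 (abs_nonneg _))
  replace h3 := abs_eq_zero.1 (le_antisymm h3 (abs_nonneg _))
  have e : r θ ^ 2 = r θb ^ 2 := by
    have h1' : r θ * cos θ = r θb * cos θb := by linarith
    have h2' : r θ * sin θ * cos φ = r θb * sin θb := by linarith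
    have a : (r θ * cos θ) ^ 2 = (r θb * cos θb) ^ 2 := by rw [h1']
    have b : (r θ * sin θ * cos φ) ^ 2 = (r θb * sin θb) ^ 2 := by rw [h2']
    have c : (r θ * sin θ * sin φ) ^ 2 = 0 := by rw [h3]; simp
    linear_combination a + b + c - r θ ^ 2 * sin_sq_add_cos_sq θ +
      r θb ^ 2 * sin_sq_add_cos_sq θb - r θ ^ 2 * sin θ ^ 2 * sin_sq_add_cos_sq φ
  have e' : r θ = r θb := by
    rwa [sq_eq_sq₀ (hpos _).le (hpos _).le] at e
  rw [e', ← mul_sub] at h1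
  have := (mul_eq_zero.1 h1).resolve_left (hpos θb).ne'
  exact injOn_cos h hb (by linarith)

/-- bounded quotient -/
theorem VcBM.div {α : Type} [MeasurableSpace α] {f b : α → ℝ} (hf : Measurable f)
    (hb : Measurable b) (h : ∀ x, |f x| ≤ b x) : VcBM (fun x => f x / b x) := by
  refine ⟨hf.div hb, 1, fun x => ?_⟩
  have h0 : 0 ≤ b x := (abs_nonneg _).trans (h x)
  rw [abs_div, abs_of_nonneg h0]
  exact div_le_one_of_le₀ (h x) h0

theorem vc_lip_ac {f : ℝ → ℝ} {a b C : ℝ} (h : ∀ x y, |f x - f y| ≤ C * |x - y|) :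
    AbsolutelyContinuousOnInterval f a b := by
  have : LipschitzWith C.toNNReal f := by
    refine LipschitzWith.of_dist_le_mul fun x y => ?_
    rw [Real.dist_eq, Real.dist_eq]
    exact (h x y).trans (mul_le_mul_of_nonneg_right (Real.le_coe_toNNReal C) (abs_nonneg _))
  exact (this.lipschitzOnWith (s := uIcc a b)).absolutelyContinuousOnInterval

/-- Fundamental theorem for Lipschitz functions with a.e. derivative. -/
theorem vc_ftc {f f' : ℝ → ℝ} {a b : ℝ} (h : AbsolutelyContinuousOnInterval f a b)
    (hd : ∀ᵐ x, x ∈ uIoc a b → HasDerivAt f (f' x) x) : ∫ x in a..b, f' x = f b - f a := by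
  rw [← h.integral_deriv_eq_sub]
  apply intervalIntegral.integral_congr_ae
  filter_upwards [hd] with x hx hx'
  exact (hx hx').deriv.symm

section Main
variable {r : ℝ → ℝ} {K : NNReal} {B : ℝ}

theorem vc_lip (hL : LipschitzWith K r) (x y : ℝ) : |r x - r y| ≤ K * |x - y| := by
  simpa [Real.dist_eq] using hL.dist_le_mul x y

theorem vc_rho_lip (hL : LipschitzWith K r) (hpos : ∀ θ, 0 < r θ) (hB : ∀ θ, r θ ≤ B) (x y : ℝ) :
    |r x * sin x - r y * sin y| ≤ (K + B) * |x - y| := by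
  have e : r x * sin x - r y * sin y = (r x - r y) * sin x + r y * (sin x - sin y) := by ring
  rw [e]
  refine (abs_add_le _ _).trans ?_
  rw [abs_mul, abs_mul, abs_of_pos (hpos y), add_mul]
  have h2 : |sin x - sin y| ≤ |x - y| := Real.abs_sin_sub_sin_le x y
  refine add_le_add ?_ (mul_le_mul (hB y) h2 (abs_nonneg _) ((hpos y).le.trans (hB y)))
  calc _ ≤ |r x - r y| * 1 := mul_le_mul_of_nonneg_left (abs_sin_le_one x) (abs_nonneg _)
    _ ≤ _ := by rw [mul_one]; exact vc_lip hL x y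

theorem vc_z_lip (hL : LipschitzWith K r) (hpos : ∀ θ, 0 < r θ) (hB : ∀ θ, r θ ≤ B) (x y : ℝ) :
    |r x * cos x - r y * cos y| ≤ (K + B) * |x - y| := by
  have e : r x * cos x - r y * cos y = (r x - r y) * cos x + r y * (cos x - cos y) := by ring
  rw [e]
  refine (abs_add_le _ _).trans ?_
  rw [abs_mul, abs_mul, abs_of_pos (hpos y), add_mul]
  have h2 : |cos x - cos y| ≤ |x - y| := Real.abs_cos_sub_cos_le x y
  refine add_le_add ?_ (mul_le_mul (hB y) h2 (abs_nonneg _) ((hpos y).le.trans (hB y)))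
  calc _ ≤ |r x - r y| * 1 := mul_le_mul_of_nonneg_left (abs_cos_le_one x) (abs_nonneg _)
    _ ≤ _ := by rw [mul_one]; exact vc_lip hL x y

theorem vc_beta_lip (hL : LipschitzWith K r) (hpos : ∀ θ, 0 < r θ) (hB : ∀ θ, r θ ≤ B)
    (θb φ x y : ℝ) :
    |betaR r x θb φ - betaR r y θb φ| ≤ (3 * (K + B)) * |x - y| := by
  have h1 := vc_rho_lip hL hpos hB x y
  have h2 := vc_z_lip hL hpos hB x y
  set b1 := betaR r x θb φ with hb1
  set b2 := betaR r y θb φ with hb2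
  have p1 : 0 ≤ b1 := vc_beta_nonneg _ _ _ _
  have p2 : 0 ≤ b2 := vc_beta_nonneg _ _ _ _
  have hC : 0 ≤ (K + B) * |x - y| := (abs_nonneg _).trans h1
  rcases (add_nonneg p1 p2).eq_or_lt with h0 | h0
  · have e1 : b1 = 0 := by linarith
    have e2 : b2 = 0 := by linarith
    rw [e1, e2]; simp; linarith
  refine le_of_mul_le_mul_right ?_ h0
  have e : (b1 - b2) * (b1 + b2) =
      (cos φ * (r x * sin x - r y * sin y)) *
        ((r x * sin x * cos φ - r θb * sin θb) + (r y * sin y * cos φ - r θb * sin θb))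
      + (sin φ * (r x * sin x - r y * sin y)) * (r x * sin x * sin φ + r y * sin y * sin φ)
      + (r x * cos x - r y * cos y) *
        ((r x * cos x - r θb * cos θb) + (r y * cos y - r θb * cos θb)) := by
    linear_combination vc_beta_sq r x θb φ - vc_beta_sq r y θb φ
  have q1 : |(r x * sin x * cos φ - r θb * sin θb) + (r y * sin y * cos φ - r θb * sin θb)|
      ≤ b1 + b2 := (abs_add_le _ _).trans (add_le_add (vc_b2 _ _ _ _) (vc_b2 _ _ _ _))
  have q2 : |r x * sin x * sin φ + r y * sin y * sin φ|
      ≤ b1 + b2 := (abs_add_le _ _).trans (add_le_add (vc_b3 _ _ _ _) (vc_b3 _ _ _ _))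
  have q3 : |(r x * cos x - r θb * cos θb) + (r y * cos y - r θb * cos θb)|
      ≤ b1 + b2 := (abs_add_le _ _).trans (add_le_add (vc_b1 _ _ _ _) (vc_b1 _ _ _ _))
  have s1 : |cos φ * (r x * sin x - r y * sin y)| ≤ (K + B) * |x - y| := by
    rw [abs_mul]
    exact (mul_le_of_le_one_left (abs_nonneg _) (abs_cos_le_one φ)).trans h1
  have s2 : |sin φ * (r x * sin x - r y * sin y)| ≤ (K + B) * |x - y| := by
    rw [abs_mul]
    exact (mul_le_of_le_one_left (abs_nonneg _) (abs_sin_le_one φ)).trans h1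
  calc |b1 - b2| * (b1 + b2) = |(b1 - b2) * (b1 + b2)| := by rw [abs_mul, abs_of_pos h0]
    _ ≤ (K + B) * |x - y| * (b1 + b2) + (K + B) * |x - y| * (b1 + b2)
        + (K + B) * |x - y| * (b1 + b2) := by
      rw [e]
      refine (abs_add_le _ _).trans (add_le_add ((abs_add_le _ _).trans (add_le_add ?_ ?_)) ?_)
      · rw [abs_mul]; exact mul_le_mul s1 q1 (abs_nonneg _) hC
      · rw [abs_mul]; exact mul_le_mul s2 q2 (abs_nonneg _) hC
      · rw [abs_mul]; exact mul_le_mul h2 q3 (abs_nonneg _) hC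
    _ = _ := by ring

/-- derivative of β in θ -/
theorem vc_beta_deriv {θ θb φ : ℝ} (hd : DifferentiableAt ℝ r θ) (hb : 0 < betaR r θ θb φ) :
    HasDerivAt (fun x => betaR r x θb φ)
      (((r θ * cos θ - r θb * cos θb) * (deriv r θ * cos θ - r θ * sin θ)
        + (r θ * sin θ - r θb * sin θb * cos φ) * (deriv r θ * sin θ + r θ * cos θ))
        / betaR r θ θb φ) θ := by
  have hr := hd.hasDerivAt
  have h1 := hr.fun_mul (hasDerivAt_sin θ)
  have h2 := hr.fun_mul (hasDerivAt_cos θ)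
  have h3 := ((((h1.mul_const (cos φ)).sub_const (r θb * sin θb)).fun_pow 2).fun_add
    ((h1.mul_const (sin φ)).fun_pow 2)).fun_add ((h2.sub_const (r θb * cos θb)).fun_pow 2)
  have hne : (r θ * sin θ * cos φ - r θb * sin θb) ^ 2 + (r θ * sin θ * sin φ) ^ 2
      + (r θ * cos θ - r θb * cos θb) ^ 2 ≠ 0 := by
    rw [← vc_beta_sq]; positivity
  have h4 := h3.sqrt hne
  have e : (fun x => betaR r x θb φ) = fun x =>
      √((r x * sin x * cos φ - r θb * sin θb) ^ 2 + (r x * sin x * sin φ) ^ 2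
      + (r x * cos x - r θb * cos θb) ^ 2) := by
    funext x
    rw [← vc_beta_sq, Real.sqrt_sq (vc_beta_nonneg _ _ _ _)]
  rw [e]
  convert h4 using 1
  rw [← vc_beta_sq, Real.sqrt_sq (vc_beta_nonneg _ _ _ _)]
  field_simp
  push_cast
  linear_combination (-2 * r θ * sin θ * (deriv r θ * sin θ + r θ * cos θ)) * sin_sq_add_cos_sq φ

/-- derivative of β in φ -/
theorem vc_beta_deriv_phi {θ θb φ : ℝ} (hb : 0 < betaR r θ θb φ) :
    HasDerivAt (fun x => betaR r θ θb x)
      (r θ * sin θ * (r θb * sin θb) * sin φ / betaR r θ θb φ) φ := by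
  have h3 := (((((hasDerivAt_cos φ).const_mul (r θ * sin θ)).sub_const (r θb * sin θb)).fun_pow
    2).fun_add (((hasDerivAt_sin φ).const_mul (r θ * sin θ)).fun_pow 2)).add_const
      ((r θ * cos θ - r θb * cos θb) ^ 2)
  have hne : (r θ * sin θ * cos φ - r θb * sin θb) ^ 2 + (r θ * sin θ * sin φ) ^ 2
      + (r θ * cos θ - r θb * cos θb) ^ 2 ≠ 0 := by
    rw [← vc_beta_sq]; positivity
  have h4 := h3.sqrt hne
  have e : (fun x => betaR r θ θb x) = fun x =>
      √((r θ * sin θ * cos x - r θb * sin θb) ^ 2 + (r θ * sin θ * sin x) ^ 2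
      + (r θ * cos θ - r θb * cos θb) ^ 2) := by
    funext x
    rw [← vc_beta_sq, Real.sqrt_sq (vc_beta_nonneg _ _ _ _)]
  rw [e]
  convert h4 using 1
  rw [← vc_beta_sq, Real.sqrt_sq (vc_beta_nonneg _ _ _ _)]
  field_simp
  push_cast
  ring

end Main

section Main2
variable {r : ℝ → ℝ} {K : NNReal} {B : ℝ}

/-- θ-derivative of `ρ β cos φ` -/
def vcH1 (r : ℝ → ℝ) (θ φ θb : ℝ) : ℝ :=
  (deriv r θ * sin θ + r θ * cos θ) * (betaR r θ θb φ * cos φ)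
  + r θ * sin θ * cos φ *
    ((r θ * cos θ - r θb * cos θb) / betaR r θ θb φ * (deriv r θ * cos θ - r θ * sin θ)
     + (r θ * sin θ - r θb * sin θb * cos φ) / betaR r θ θb φ
        * (deriv r θ * sin θ + r θ * cos θ))

/-- φ-derivative of `β sin φ` -/
def vcH2 (r : ℝ → ℝ) (θ φ θb : ℝ) : ℝ :=
  betaR r θ θb φ * cos φ + r θb * sin θb * sin φ * (r θ * sin θ * sin φ / betaR r θ θb φ)

def vcG (r : ℝ → ℝ) (θb : ℝ) : ℝ :=
  (r θb * sin θb - deriv r θb * cos θb) * (r θb * sin θb)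

def vcK1 (r : ℝ → ℝ) (θ φ θb : ℝ) : ℝ :=
  (r θb * Real.sin θb - deriv r θb * Real.cos θb) / betaR r θ θb φ *
        (r θb * Real.sin θb) *
        (r θ * Real.cos φ -
          r θb * (Real.cos θb * Real.cos θ * Real.cos φ + Real.sin θb * Real.sin θ))

def vcK2 (r : ℝ → ℝ) (θ φ θb : ℝ) : ℝ :=
  (r θb * Real.sin θb - deriv r θb * Real.cos θb) / betaR r θ θb φ *
        (r θb * Real.sin θb) *
        (-(r θb) * Real.sin θ * Real.cos θb * Real.cos φ + r θb * Real.cos θ * Real.sin θb)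

theorem vcK1_eq (r : ℝ → ℝ) (θ φ θb : ℝ) : vcK1 r θ φ θb =
    vcG r θb * (cos φ * cos θ * ((r θ * cos θ - r θb * cos θb) / betaR r θ θb φ)
      + sin θ * ((r θ * sin θ * cos φ - r θb * sin θb) / betaR r θ θb φ)) := by
  unfold vcK1 vcG
  simp only [div_eq_mul_inv]
  generalize (betaR r θ θb φ)⁻¹ = i
  linear_combination (-(r θb * sin θb - deriv r θb * cos θb) * i * (r θb * sin θb) * r θ * cos φ)
    * sin_sq_add_cos_sq θ

theorem vcK2_eq (r : ℝ → ℝ) (θ φ θb : ℝ) : vcK2 r θ φ θb =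
    vcG r θb * (sin θ * cos φ * ((r θ * cos θ - r θb * cos θb) / betaR r θ θb φ)
      - cos θ * ((r θ * sin θ * cos φ - r θb * sin θb) / betaR r θ θb φ)) := by
  unfold vcK2 vcG
  simp only [div_eq_mul_inv]
  generalize (betaR r θ θb φ)⁻¹ = i
  ring

theorem vc_key (r : ℝ → ℝ) (θ φ θb : ℝ) :
    r θ ^ 2 * sin θ * vcK2 r θ φ θb - deriv r θ * r θ * sin θ * vcK1 r θ φ θb
    = vcG r θb * ((deriv r θ * sin θ + r θ * cos θ) * vcH2 r θ φ θb - vcH1 r θ φ θb) := by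
  rw [vcK1_eq, vcK2_eq]
  unfold vcH1 vcH2
  simp only [div_eq_mul_inv]
  generalize (betaR r θ θb φ)⁻¹ = i
  linear_combination (-vcG r θb * (deriv r θ * sin θ + r θ * cos θ) * (r θ * sin θ)
    * (r θb * sin θb) * i) * sin_sq_add_cos_sq φ

theorem vc_meas_beta (hm : Measurable r) :
    Measurable (fun x : ℝ × ℝ × ℝ => betaR r x.1 x.2.2 x.2.1) := by
  unfold betaR
  fun_prop

theorem vc_bm_r (hL : LipschitzWith K r) (hpos : ∀ θ, 0 < r θ) (hB : ∀ θ, r θ ≤ B) : VcBM r :=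
  ⟨hL.continuous.measurable, B, fun x => by rw [abs_of_pos (hpos x)]; exact hB x⟩

theorem vc_bm_d (hL : LipschitzWith K r) : VcBM (deriv r) :=
  ⟨measurable_deriv r, K, fun _ => norm_deriv_le_of_lipschitz hL⟩

theorem vc_bm_sin : VcBM sin := ⟨measurable_sin, 1, abs_sin_le_one⟩

theorem vc_bm_cos : VcBM cos := ⟨measurable_cos, 1, abs_cos_le_one⟩

theorem vc_bm_G (hL : LipschitzWith K r) (hpos : ∀ θ, 0 < r θ) (hB : ∀ θ, r θ ≤ B) :
    VcBM (vcG r) := by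
  have a := vc_bm_r hL hpos hB
  exact ((a.mul vc_bm_sin).sub ((vc_bm_d hL).mul vc_bm_cos)).mul (a.mul vc_bm_sin)

theorem vc_bm_all (hL : LipschitzWith K r) (hpos : ∀ θ, 0 < r θ) (hB : ∀ θ, r θ ≤ B) :
    VcBM (fun x : ℝ × ℝ × ℝ => vcK1 r x.1 x.2.1 x.2.2) ∧
    VcBM (fun x : ℝ × ℝ × ℝ => vcK2 r x.1 x.2.1 x.2.2) ∧
    VcBM (fun x : ℝ × ℝ × ℝ => vcH1 r x.1 x.2.1 x.2.2) ∧
    VcBM (fun x : ℝ × ℝ × ℝ => vcH2 r x.1 x.2.1 x.2.2) := by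
  have m1 : Measurable (fun x : ℝ × ℝ × ℝ => x.1) := by fun_prop
  have m2 : Measurable (fun x : ℝ × ℝ × ℝ => x.2.1) := by fun_prop
  have m3 : Measurable (fun x : ℝ × ℝ × ℝ => x.2.2) := by fun_prop
  have hm := hL.continuous.measurable
  have hr := vc_bm_r hL hpos hB
  have hd := vc_bm_d hL
  have hG := (vc_bm_G hL hpos hB).comp m3
  have hbm := vc_meas_beta hm
  have hb : VcBM (fun x : ℝ × ℝ × ℝ => betaR r x.1 x.2.2 x.2.1) :=
    ⟨hbm, 2 * B, fun x => vc_b5 r B hpos hB _ _ _⟩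
  have r1 := hr.comp m1
  have r3 := hr.comp m3
  have d1 := hd.comp m1
  have s1 := vc_bm_sin.comp m1
  have s2 := vc_bm_sin.comp m2
  have s3 := vc_bm_sin.comp m3
  have c1 := vc_bm_cos.comp m1
  have c2 := vc_bm_cos.comp m2
  have c3 := vc_bm_cos.comp m3
  have q1 := VcBM.div (f := fun x : ℝ × ℝ × ℝ => r x.1 * cos x.1 - r x.2.2 * cos x.2.2)
    (by fun_prop) hbm (fun x => vc_b1 r _ _ _)
  have q2 := VcBM.div
    (f := fun x : ℝ × ℝ × ℝ => r x.1 * sin x.1 * cos x.2.1 - r x.2.2 * sin x.2.2)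
    (by fun_prop) hbm (fun x => vc_b2 r _ _ _)
  have q3 := VcBM.div (f := fun x : ℝ × ℝ × ℝ => r x.1 * sin x.1 * sin x.2.1)
    (by fun_prop) hbm (fun x => vc_b3 r _ _ _)
  have q4 := VcBM.div
    (f := fun x : ℝ × ℝ × ℝ => r x.1 * sin x.1 - r x.2.2 * sin x.2.2 * cos x.2.1)
    (by fun_prop) hbm (fun x => vc_b4 r _ _ _)
  refine ⟨?_, ?_, ?_, ?_⟩
  · simp only [vcK1_eq]
    exact hG.mul (((c2.mul c1).mul q1).add (s1.mul q2))
  · simp only [vcK2_eq]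
    exact hG.mul (((s1.mul c2).mul q1).sub (c1.mul q2))
  · unfold vcH1
    have rp := (d1.mul s1).add (r1.mul c1)
    exact (rp.mul (hb.mul c2)).add (((r1.mul s1).mul c2).mul
      ((q1.mul ((d1.mul c1).sub (r1.mul s1))).add (q4.mul rp)))
  · unfold vcH2
    exact (hb.mul c2).add (((r3.mul s3).mul s2).mul q3)

theorem vc_ae_ne (a : ℝ) : ∀ᵐ x : ℝ, x ≠ a := by
  simp [ae_iff]

theorem vc_int_H1 (hL : LipschitzWith K r) (hpos : ∀ θ, 0 < r θ) (hB : ∀ θ, r θ ≤ B)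
    (φ θb : ℝ) (hb : θb ∈ Icc 0 π) : ∫ θ in (0:ℝ)..π, vcH1 r θ φ θb = 0 := by
  have hac : AbsolutelyContinuousOnInterval
      (fun θ => r θ * sin θ * (betaR r θ θb φ * cos φ)) 0 π := by
    have h1 : AbsolutelyContinuousOnInterval (fun θ => r θ * sin θ) 0 π :=
      vc_lip_ac (vc_rho_lip hL hpos hB)
    have h2 : AbsolutelyContinuousOnInterval (fun θ => betaR r θ θb φ) 0 π :=
      vc_lip_ac (vc_beta_lip hL hpos hB θb φ)
    have h3 : AbsolutelyContinuousOnInterval (fun _ : ℝ => cos φ) 0 π :=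
      vc_lip_ac (C := 0) (by simp)
    exact h1.fun_mul (h2.fun_mul h3)
  rw [vc_ftc hac]
  · simp
  filter_upwards [hL.ae_differentiableAt_real, vc_ae_ne θb] with θ hd hne hθ
  rw [uIoc_of_le pi_pos.le] at hθ
  have hβ := vc_beta_pos r hpos θ θb φ ⟨hθ.1.le, hθ.2⟩ hb hne
  have := (hd.hasDerivAt.fun_mul (hasDerivAt_sin θ)).fun_mul
    ((vc_beta_deriv hd hβ).mul_const (cos φ))
  refine this.congr_deriv ?_
  unfold vcH1
  ring

theorem vc_int_H2 (hL : LipschitzWith K r) (hpos : ∀ θ, 0 < r θ) (hB : ∀ θ, r θ ≤ B)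
    (θ θb : ℝ) (hθ : θ ∈ Icc 0 π) (hb : θb ∈ Icc 0 π) (hne : θ ≠ θb) :
    ∫ φ in (0:ℝ)..(2 * π), vcH2 r θ φ θb = 0 := by
  have hint : IntervalIntegrable (fun φ => vcH2 r θ φ θb) volume 0 (2 * π) := by
    rw [intervalIntegrable_iff, IntegrableOn, uIoc_of_le (by positivity)]
    exact ((vc_bm_all hL hpos hB).2.2.2.comp
      (u := fun φ : ℝ => (θ, φ, θb)) (by fun_prop)).integrable _
  rw [intervalIntegral.integral_eq_sub_of_hasDerivAt
    (f := fun φ => betaR r θ θb φ * sin φ) _ hint]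
  · simp
  intro φ _
  have := (vc_beta_deriv_phi (vc_beta_pos r hpos θ θb φ hθ hb hne)).fun_mul (hasDerivAt_sin φ)
  refine this.congr_deriv ?_
  unfold vcH2
  ring

theorem vc_total (hL : LipschitzWith K r) (hpos : ∀ θ, 0 < r θ) (hB : ∀ θ, r θ ≤ B) :
    ∫ θ in (0:ℝ)..π,
      (r θ ^ 2 * sin θ * (∫ φ in (0:ℝ)..(2 * π), ∫ θb in (0:ℝ)..π, vcK2 r θ φ θb)
      - deriv r θ * r θ * sin θ * (∫ φ in (0:ℝ)..(2 * π), ∫ θb in (0:ℝ)..π, vcK1 r θ φ θb))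
      = 0 := by
  have h1 := fun φ θb hb => vc_int_H1 hL hpos hB φ θb hb
  have h2 := fun θ θb hθ hb hne => vc_int_H2 hL hpos hB θ θb hθ hb hne
  obtain ⟨bK1, bK2, bH1, bH2⟩ := vc_bm_all hL hpos hB
  have bG := vc_bm_G hL hpos hB
  have hr := vc_bm_r hL hpos hB
  have hd := vc_bm_d hL
  have h2pi : (0:ℝ) ≤ 2 * π := by positivity
  simp only [intervalIntegral.integral_of_le pi_pos.le,
    intervalIntegral.integral_of_le h2pi] at h1 h2 ⊢
  have hμ : ∀ᵐ x ∂(volume.restrict (Ioc 0 π)), x ∈ Icc 0 π :=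
    (ae_restrict_mem measurableSet_Ioc).mono fun x hx => ⟨hx.1.le, hx.2⟩
  have hμne : ∀ a : ℝ, ∀ᵐ x ∂(volume.restrict (Ioc 0 π)), x ≠ a :=
    fun a => ae_restrict_of_ae (vc_ae_ne a)
  set μ : Measure ℝ := volume.restrict (Ioc 0 π) with hμdef
  set ν : Measure ℝ := volume.restrict (Ioc 0 (2 * π)) with hνdef
  have m1 : Measurable (fun x : ℝ × ℝ × ℝ => x.1) := by fun_prop
  have m3 : Measurable (fun x : ℝ × ℝ × ℝ => x.2.2) := by fun_prop
  have hrp : VcBM (fun θ => deriv r θ * sin θ + r θ * cos θ) :=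
    (hd.mul vc_bm_sin).add (hr.mul vc_bm_cos)
  have bP1 : VcBM (fun x : ℝ × ℝ × ℝ => vcG r x.2.2 * vcH1 r x.1 x.2.1 x.2.2) :=
    (bG.comp m3).mul bH1
  have bP2 : VcBM (fun x : ℝ × ℝ × ℝ => vcG r x.2.2 *
      ((deriv r x.1 * sin x.1 + r x.1 * cos x.1) * vcH2 r x.1 x.2.1 x.2.2)) :=
    (bG.comp m3).mul ((hrp.comp m1).mul bH2)
  have sec : ∀ θ : ℝ, Measurable (fun y : ℝ × ℝ => (θ, y.1, y.2)) := fun θ => by fun_prop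
  have e : ∀ θ, r θ ^ 2 * sin θ * (∫ φ, ∫ θb, vcK2 r θ φ θb ∂μ ∂ν)
      - deriv r θ * r θ * sin θ * (∫ φ, ∫ θb, vcK1 r θ φ θb ∂μ ∂ν)
      = ∫ y : ℝ × ℝ, (vcG r y.2 *
          ((deriv r θ * sin θ + r θ * cos θ) * vcH2 r θ y.1 y.2)
          - vcG r y.2 * vcH1 r θ y.1 y.2) ∂(ν.prod μ) := by
    intro θ
    have i1 := (bK1.comp (sec θ)).integrable (ν.prod μ)
    have i2 := (bK2.comp (sec θ)).integrable (ν.prod μ)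
    have j1 := integral_prod _ i1
    have j2 := integral_prod _ i2
    simp only at j1 j2
    rw [← j1, ← j2, ← integral_const_mul, ← integral_const_mul,
      ← integral_sub (i2.const_mul _) (i1.const_mul _)]
    refine integral_congr_ae (Eventually.of_forall fun y => ?_)
    simp only
    rw [vc_key]; ring
  simp only [e]
  have I1 := bP1.integrable (μ.prod (ν.prod μ))
  have I2 := bP2.integrable (μ.prod (ν.prod μ))
  have t := integral_prod _ (I2.sub I1)
  simp only [Pi.sub_apply] at t
  rw [← t, integral_sub I2 I1, integral_prod_symm _ I1, integral_prod _ I2]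
  have z1 : ∫ y : ℝ × ℝ, ∫ θ, vcG r y.2 * vcH1 r θ y.1 y.2 ∂μ ∂(ν.prod μ) = 0 := by
    refine integral_eq_zero_of_ae ?_
    have : ∀ᵐ y ∂(ν.prod μ), y.2 ∈ Icc 0 π := Measure.quasiMeasurePreserving_snd.ae hμ
    filter_upwards [this] with y hy
    rw [integral_const_mul, h1 _ _ hy]; simp
  have z2 : ∀ᵐ θ ∂μ, ∫ y : ℝ × ℝ, vcG r y.2 *
          ((deriv r θ * sin θ + r θ * cos θ) * vcH2 r θ y.1 y.2) ∂(ν.prod μ) = 0 := by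
    filter_upwards [hμ] with θ hθ
    rw [integral_prod_symm _ ((bP2.comp (sec θ)).integrable (ν.prod μ))]
    refine integral_eq_zero_of_ae ?_
    filter_upwards [hμ, hμne θ] with θb hb hne
    rw [integral_const_mul, integral_const_mul, h2 _ _ hθ hb hne.symm]; simp
  rw [z1, integral_eq_zero_of_ae z2, sub_zero]

theorem vc_cpart (hL : LipschitzWith K r) (hpos : ∀ θ, 0 < r θ) (hB : ∀ θ, r θ ≤ B) :
    ∫ θ in (0:ℝ)..π, (deriv r θ * sin θ + r θ * cos θ) * (r θ * sin θ) = 0 := by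
  have h1 : AbsolutelyContinuousOnInterval (fun θ => r θ * sin θ) 0 π :=
      vc_lip_ac (vc_rho_lip hL hpos hB)
  have h2 : ∫ θ in (0:ℝ)..π, 2 * ((deriv r θ * sin θ + r θ * cos θ) * (r θ * sin θ)) = 0 := by
    rw [vc_ftc (h1.fun_mul h1)]
    · simp
    filter_upwards [hL.ae_differentiableAt_real] with θ hd _
    have := (hd.hasDerivAt.fun_mul (hasDerivAt_sin θ))
    refine (this.fun_mul this).congr_deriv ?_
    ring
  rw [intervalIntegral.integral_const_mul] at h2
  linarith

theorem vc_part1_ext (hL : LipschitzWith K r) (hpos : ∀ θ, 0 < r θ) (hB : ∀ θ, r θ ≤ B)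
    (c : ℝ) : ∫ θ in (0:ℝ)..π,
        (A2op r c θ - deriv r θ * A1op r c θ) * r θ ^ 2 * Real.sin θ = 0 := by
  have ht := vc_total hL hpos hB
  have hc := vc_cpart hL hpos hB
  have e : ∀ θ, (A2op r c θ - deriv r θ * A1op r c θ) * r θ ^ 2 * Real.sin θ
    = -(1 / (8 * π)) * (r θ ^ 2 * sin θ * (∫ φ in (0:ℝ)..(2 * π), ∫ θb in (0:ℝ)..π, vcK2 r θ φ θb)
      - deriv r θ * r θ * sin θ * (∫ φ in (0:ℝ)..(2 * π), ∫ θb in (0:ℝ)..π, vcK1 r θ φ θb))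
      - c * ((deriv r θ * sin θ + r θ * cos θ) * (r θ * sin θ)) := by
    intro θ
    have := hpos θ
    have e1 : A1op r c θ = -(1 / (8 * π * r θ)) *
      (∫ φ in (0:ℝ)..(2 * π), ∫ θb in (0:ℝ)..π, vcK1 r θ φ θb) + c * sin θ / r θ := rfl
    have e2 : A2op r c θ = -(1 / (8 * π)) *
      (∫ φ in (0:ℝ)..(2 * π), ∫ θb in (0:ℝ)..π, vcK2 r θ φ θb) - c * cos θ := rfl
    rw [e1, e2]
    generalize (∫ φ in (0:ℝ)..(2 * π), ∫ θb in (0:ℝ)..π, vcK1 r θ φ θb) = j1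
    generalize (∫ φ in (0:ℝ)..(2 * π), ∫ θb in (0:ℝ)..π, vcK2 r θ φ θb) = j2
    field_simp
    ring
  simp only [e]
  have hr := vc_bm_r hL hpos hB
  have hd := vc_bm_d hL
  obtain ⟨bK1, bK2, -, -⟩ := vc_bm_all hL hpos hB
  have key : ∀ k : ℝ → ℝ → ℝ → ℝ, VcBM (fun x : ℝ × ℝ × ℝ => k x.1 x.2.1 x.2.2) →
      VcBM (fun θ => ∫ φ in (0:ℝ)..(2 * π), ∫ θb in (0:ℝ)..π, k θ φ θb) := by
    intro k hk
    obtain ⟨hm, C, hC⟩ := hk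
    constructor
    · have h2pi : (0:ℝ) ≤ 2 * π := by positivity
      simp only [intervalIntegral.integral_of_le pi_pos.le,
        intervalIntegral.integral_of_le h2pi]
      have s1 : StronglyMeasurable (fun p : (ℝ × ℝ) × ℝ => k p.1.1 p.1.2 p.2) :=
        (hm.comp (by fun_prop : Measurable fun p : (ℝ × ℝ) × ℝ =>
          (p.1.1, p.1.2, p.2))).stronglyMeasurable
      have s2 := s1.integral_prod_right' (ν := volume.restrict (Ioc 0 π))
      exact (s2.integral_prod_right' (ν := volume.restrict (Ioc 0 (2 * π)))).measurable
    · refine ⟨C * |π - 0| * |2 * π - 0|, fun θ => ?_⟩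
      rw [← Real.norm_eq_abs]
      refine intervalIntegral.norm_integral_le_of_norm_le_const fun φ _ => ?_
      exact intervalIntegral.norm_integral_le_of_norm_le_const fun θb _ => hC (θ, φ, θb)
  have J1 := key _ bK1
  have J2 := key _ bK2
  have hs := vc_bm_sin
  have hr2 : VcBM (fun θ => r θ ^ 2) := by simpa only [pow_two] using hr.mul hr
  have b1 := (((hr2.mul hs).mul J2).sub (((hd.mul hr).mul hs).mul J1))
  have b2 := ((hd.mul hs).add (hr.mul vc_bm_cos)).mul (hr.mul hs)
  rw [intervalIntegral.integral_sub, intervalIntegral.integral_const_mul,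
    intervalIntegral.integral_const_mul, ht, hc]
  · simp
  · rw [intervalIntegrable_iff, IntegrableOn, uIoc_of_le pi_pos.le]; exact (b1.integrable _).const_mul _
  · rw [intervalIntegrable_iff, IntegrableOn, uIoc_of_le pi_pos.le]; exact (b2.integrable _).const_mul _

end Main2

theorem vc_part1 (r : ℝ → ℝ) (K : NNReal) (hL : LipschitzOnWith K r (Set.Icc 0 π))
    (hpos : ∀ θ ∈ Set.Icc (0:ℝ) π, 0 < r θ) (c : ℝ) :
    (∫ θ in (0:ℝ)..π, (A2op r c θ - deriv r θ * A1op r c θ) * r θ ^ 2 * Real.sin θ) = 0 := by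
  set R : ℝ → ℝ := fun θ => r (projIcc 0 π pi_pos.le θ) with hR
  have hRe : ∀ θ ∈ Icc 0 π, R θ = r θ := fun θ hθ => by simp [hR, projIcc_of_mem _ hθ]
  have hRL : LipschitzWith K R := by
    have := (lipschitzOnWith_iff_restrict.1 hL).comp (LipschitzWith.projIcc pi_pos.le)
    rw [mul_one] at this
    exact this
  obtain ⟨B, hB⟩ : ∃ B, ∀ θ ∈ Icc 0 π, r θ ≤ B := by
    obtain ⟨B, hB⟩ := (isCompact_Icc.image_of_continuousOn hL.continuousOn).bddAbove
    exact ⟨B, fun θ hθ => hB ⟨θ, hθ, rfl⟩⟩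
  have hfin := vc_part1_ext hRL (fun θ => hpos _ (projIcc 0 π pi_pos.le θ).2)
    (fun θ => hB _ (projIcc 0 π pi_pos.le θ).2) c
  have hDe : ∀ θ ∈ Ioo 0 π, deriv R θ = deriv r θ := fun θ hθ => by
    apply Filter.EventuallyEq.deriv_eq
    filter_upwards [Ioo_mem_nhds hθ.1 hθ.2] with x hx using hRe x ⟨hx.1.le, hx.2.le⟩
  have hcong : ∀ f g : ℝ → ℝ, (∀ θ ∈ Ioo 0 π, f θ = g θ) →
      ∫ θ in (0:ℝ)..π, f θ = ∫ θ in (0:ℝ)..π, g θ := by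
    intro f g h
    apply intervalIntegral.integral_congr_ae
    filter_upwards [vc_ae_ne π] with x hx hx'
    rw [uIoc_of_le pi_pos.le] at hx'
    exact h x ⟨hx'.1, lt_of_le_of_ne hx'.2 hx⟩
  refine Eq.trans (hcong _ _ ?_) hfin
  intro θ hθ
  have e1 : A1op R c θ = A1op r c θ := by
    unfold A1op
    rw [hRe θ ⟨hθ.1.le, hθ.2.le⟩]
    congr 2
    refine intervalIntegral.integral_congr fun φ _ => hcong _ _ fun θb hb => ?_
    simp only [betaR, hDe θb hb, hRe θb ⟨hb.1.le, hb.2.le⟩, hRe θ ⟨hθ.1.le, hθ.2.le⟩]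
  have e2 : A2op R c θ = A2op r c θ := by
    unfold A2op
    congr 2
    refine intervalIntegral.integral_congr fun φ _ => hcong _ _ fun θb hb => ?_
    simp only [betaR, hDe θb hb, hRe θb ⟨hb.1.le, hb.2.le⟩, hRe θ ⟨hθ.1.le, hθ.2.le⟩]
  rw [e1, e2, hDe θ hθ, hRe θ ⟨hθ.1.le, hθ.2.le⟩]

theorem vc_part2 (r : ℝ → ℝ → ℝ) (K : NNReal) (F : ℝ → ℝ → ℝ) (M : ℝ)
    (hL : ∀ t, LipschitzOnWith K (r t) (Set.Icc 0 π))
    (hD : ∀ t, ∀ θ ∈ Set.Ioo (0:ℝ) π, HasDerivAt (fun τ => r τ θ) (F t θ) t)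
    (hM : ∀ t, ∀ θ ∈ Set.Ioo (0:ℝ) π, |F t θ| ≤ M)
    (h0 : ∀ t, (∫ θ in (0:ℝ)..π, F t θ * r t θ ^ 2 * Real.sin θ) = 0) (t₁ t₂ : ℝ) :
    (∫ θ in (0:ℝ)..π, r t₁ θ ^ 3 * Real.sin θ) = ∫ θ in (0:ℝ)..π, r t₂ θ ^ 3 * Real.sin θ := by
  have hae : ∀ᵐ θ : ℝ, θ ∈ uIoc 0 π → θ ∈ Ioo 0 π := by
    filter_upwards [vc_ae_ne π] with x hx hx'
    rw [uIoc_of_le pi_pos.le] at hx'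
    exact ⟨hx'.1, lt_of_le_of_ne hx'.2 hx⟩
  have hcont : ∀ t, ContinuousOn (r t) (uIcc 0 π) := fun t => by
    rw [uIcc_of_le pi_pos.le]; exact (hL t).continuousOn
  have hmeas : ∀ t, AEStronglyMeasurable (r t) (volume.restrict (uIoc 0 π)) := fun t =>
    ((hcont t).mono uIoc_subset_uIcc).aestronglyMeasurable measurableSet_uIoc
  have hFm : ∀ t, AEStronglyMeasurable (F t) (volume.restrict (uIoc 0 π)) := by
    intro t
    refine aestronglyMeasurable_of_tendsto_ae (u := atTop)
      (f := fun (n : ℕ) θ => ((n:ℝ) + 1) * (r (t + ((n:ℝ) + 1)⁻¹) θ - r t θ))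
      (fun n => ((hmeas _).sub (hmeas _)).const_mul _) ?_
    rw [ae_restrict_iff' measurableSet_uIoc]
    filter_upwards [hae] with θ hθ hθ'
    have h := (hD t θ (hθ hθ')).tendsto_slope_zero
    have ht : Tendsto (fun n : ℕ => ((n:ℝ) + 1)⁻¹) atTop (nhdsWithin 0 {0}ᶜ) := by
      rw [tendsto_nhdsWithin_iff]
      refine ⟨?_, Eventually.of_forall fun n => ?_⟩
      · simpa using tendsto_one_div_add_atTop_nhds_zero_nat (𝕜 := ℝ)
      · have : (0:ℝ) < (n:ℝ) + 1 := by positivity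
        simp [this.ne']
    have := h.comp ht
    refine this.congr fun n => ?_
    simp
  have hV : ∀ t, HasDerivAt (fun τ => ∫ θ in (0:ℝ)..π, r τ θ ^ 3 * Real.sin θ) 0 t := by
    intro t
    obtain ⟨B, hB⟩ : ∃ B, ∀ θ ∈ Icc 0 π, |r t θ| ≤ B := by
      obtain ⟨B, hB⟩ := (isCompact_Icc.image_of_continuousOn (hL t).continuousOn.abs).bddAbove
      exact ⟨B, fun θ hθ => hB ⟨θ, hθ, rfl⟩⟩
    have hMn : 0 ≤ M := (abs_nonneg _).trans
      (hM 0 (π / 2) ⟨by positivity, by linarith [pi_pos]⟩)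
    have hbd : ∀ θ ∈ Ioo 0 π, ∀ τ ∈ Metric.ball t 1, |r τ θ| ≤ B + M := by
      intro θ hθ τ hτ
      have h := Convex.norm_image_sub_le_of_norm_hasDerivWithin_le (s := univ)
        (f := fun τ => r τ θ) (f' := fun τ => F τ θ) (x := t) (y := τ) (C := M)
        (fun x _ => (hD x θ hθ).hasDerivWithinAt) (fun x _ => hM x θ hθ) convex_univ
        (mem_univ _) (mem_univ _)
      rw [Metric.mem_ball, Real.dist_eq] at hτ
      have h2 := hB θ ⟨hθ.1.le, hθ.2.le⟩
      simp only [Real.norm_eq_abs] at h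
      have h3 : |r τ θ - r t θ| ≤ M := h.trans (mul_le_of_le_one_right hMn hτ.le)
      have h4 := abs_sub_abs_le_abs_sub (r τ θ) (r t θ)
      linarith
    have hmain := intervalIntegral.hasDerivAt_integral_of_dominated_loc_of_deriv_le
      (μ := volume) (a := 0) (b := π) (F := fun τ θ => r τ θ ^ 3 * Real.sin θ)
      (F' := fun τ θ => 3 * (F τ θ * r τ θ ^ 2 * Real.sin θ)) (x₀ := t)
      (s := Metric.ball t 1) (bound := fun _ => 3 * (M * (B + M) ^ 2 * 1))
      (Metric.ball_mem_nhds t one_pos)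
      (Eventually.of_forall fun τ =>
        ((hmeas τ).pow 3).mul continuous_sin.aestronglyMeasurable)
      (((hcont t).pow 3).mul continuous_sin.continuousOn).intervalIntegrable
      ((((hFm t).mul ((hmeas t).pow 2)).mul continuous_sin.aestronglyMeasurable).const_mul 3)
      ?_ intervalIntegrable_const ?_
    · have := hmain.2
      rwa [intervalIntegral.integral_const_mul, h0 t, mul_zero] at this
    · filter_upwards [hae] with θ hθ hθ' τ hτ
      have h1 := hbd θ (hθ hθ') τ hτ
      have h2 := hM τ θ (hθ hθ')
      rw [Real.norm_eq_abs, abs_mul, abs_mul, abs_mul, abs_pow]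
      have : |(3:ℝ)| = 3 := by norm_num
      rw [this]
      gcongr
      exact abs_sin_le_one θ
    · filter_upwards [hae] with θ hθ hθ' τ hτ
      have := ((hD τ θ (hθ hθ')).fun_pow 3).mul_const (sin θ)
      refine this.congr_deriv ?_
      push_cast
      ring
  exact is_const_of_deriv_eq_zero (fun t => (hV t).differentiableAt) (fun t => (hV t).deriv) t₁ t₂

theorem volume_conservation_identity :
    -- the integral identity, for any Lipschitz positive radius and arbitrary ċ₃
    (∀ (r : ℝ → ℝ) (K : NNReal), LipschitzOnWith K r (Set.Icc 0 π) →
      (∀ θ ∈ Set.Icc (0:ℝ) π, 0 < r θ) → ∀ c3dot : ℝ,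
      (∫ θ in (0:ℝ)..π,
        (A2op r c3dot θ - deriv r θ * A1op r c3dot θ) * r θ ^ 2 * Real.sin θ) = 0) ∧
    -- consequence along solutions of the hyperbolic equation
    (∀ (r : ℝ → ℝ → ℝ) (K : NNReal) (cdot : ℝ → ℝ) (δ M : ℝ), 0 < δ →
      (∀ t, LipschitzOnWith K (r t) (Set.Icc 0 π)) →
      (∀ t, ∀ θ ∈ Set.Icc (0:ℝ) π, δ ≤ r t θ) →
      -- the equation ∂_t r + A₁[r] ∂_θ r = A₂[r]
      (∀ t, ∀ θ ∈ Set.Ioo (0:ℝ) π,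
        HasDerivAt (fun τ => r τ θ)
          (A2op (r t) (cdot t) θ - A1op (r t) (cdot t) θ * deriv (r t) θ) t) →
      (∀ t, ∀ θ ∈ Set.Ioo (0:ℝ) π,
        |A2op (r t) (cdot t) θ - A1op (r t) (cdot t) θ * deriv (r t) θ| ≤ M) →
      (∀ t, (∫ θ in (0:ℝ)..π,
          deriv (fun τ => r τ θ) t * r t θ ^ 2 * Real.sin θ) = 0) ∧
      (∀ t₁ t₂ : ℝ,
        (2 * π / 3) * (∫ θ in (0:ℝ)..π, r t₁ θ ^ 3 * Real.sin θ)
          = (2 * π / 3) * ∫ θ in (0:ℝ)..π, r t₂ θ ^ 3 * Real.sin θ)) := by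
  refine ⟨fun r K hL hpos c => vc_part1 r K hL hpos c, ?_⟩
  intro r K cdot δ M hδ hL hpos hD hM
  have h1 : ∀ t, (∫ θ in (0:ℝ)..π,
      (A2op (r t) (cdot t) θ - A1op (r t) (cdot t) θ * deriv (r t) θ) * r t θ ^ 2
        * Real.sin θ) = 0 := by
    intro t
    have := vc_part1 (r t) K (hL t) (fun θ hθ => hδ.trans_le (hpos t θ hθ)) (cdot t)
    simpa only [mul_comm (deriv (r t) _)] using this
  refine ⟨fun t => ?_, fun t₁ t₂ => ?_⟩
  · refine Eq.trans (intervalIntegral.integral_congr_ae ?_) (h1 t)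
    filter_upwards [vc_ae_ne π] with x hx hx'
    rw [uIoc_of_le pi_pos.le] at hx'
    rw [(hD t x ⟨hx'.1, lt_of_le_of_ne hx'.2 hx⟩).deriv]
  · rw [vc_part2 r K _ M hL hD hM h1 t₁ t₂]
end
end
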